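/- Let d ≥ 1, let 0 ≤ β ≤ 2, let ν be a Lévy measure on ℝ^d with ∫_{‖x‖<1} ‖x‖^β ν(dx) < ∞ and let γ ∈ ℝ^d; if β ≤ 1, assume additionally that γ = ∫_{‖y‖≤1} y ν(dy) (i.e. the drift γ₀ vanishes). Let (p_t)_{t≥0} be the marginal laws of the Lévy process with triplet (0, γ, ν). Then for every bounded continuous function F : ℝ^d → ℝ satisfying |F(x) − F(0)| ≤ C‖x‖^β for all ‖x‖ < 1 and some constant C > 0, one has lim_{t→0+} t^{−1} ∫_{ℝ^d} (F(x) − F(0)) p_t(dx) = ∫_{ℝ^d} (F(x) − F(0)) ν(dx), the integral on the right being absolutely convergent. -/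

import Mathlib

open MeasureTheory Filter
open scoped Topology RealInnerProductSpace ENNReal

/-! ### Elementary estimates -/

lemma norm_exp_I_mul_ofReal_sub_one_le_rpow {β : ℝ} (hβ0 : 0 ≤ β) (hβ1 : β ≤ 1) (v : ℝ) :
    ‖Complex.exp (Complex.I * v) - 1‖ ≤ 2 * |v| ^ β := by
  rcases le_total |v| 1 with hv | hv
  · have h1 : ‖Complex.exp (Complex.I * v) - 1‖ ≤ |v| := Real.norm_exp_I_mul_ofReal_sub_one_le
    have h2 : |v| ≤ |v| ^ β := Real.self_le_rpow_of_le_one (abs_nonneg v) hv hβ1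
    linarith [abs_nonneg v]
  · have h1 : ‖Complex.exp (Complex.I * v) - 1‖ ≤ 2 := by
      refine (norm_sub_le _ _).trans ?_
      rw [Complex.norm_exp_I_mul_ofReal, norm_one]; norm_num
    have h2 : 1 ≤ |v| ^ β := Real.one_le_rpow hv hβ0
    linarith

lemma norm_exp_I_mul_ofReal_sub_one_sub_le (v : ℝ) :
    ‖Complex.exp (Complex.I * v) - 1 - Complex.I * v‖ ≤ 2 + |v| := by
  refine (norm_sub_le _ _).trans (add_le_add ?_ (by simp))
  refine (norm_sub_le _ _).trans ?_
  rw [Complex.norm_exp_I_mul_ofReal, norm_one]; norm_num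

lemma norm_exp_I_mul_ofReal_sub_one_sub_le_rpow {β : ℝ} (hβ1 : 1 ≤ β) (hβ2 : β ≤ 2) (v : ℝ) :
    ‖Complex.exp (Complex.I * v) - 1 - Complex.I * v‖ ≤ 3 * |v| ^ β := by
  rcases le_total |v| 1 with hv | hv
  · have h1 : ‖Complex.exp (Complex.I * v) - 1 - Complex.I * v‖ ≤ |v| ^ 2 := by
      have := Complex.norm_exp_sub_one_sub_id_le (x := Complex.I * v) (by simpa using hv)
      simpa using this
    have h2 : |v| ^ 2 ≤ |v| ^ β := by
      rw [← Real.rpow_natCast]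
      rcases (abs_nonneg v).eq_or_lt with h0 | h0
      · rw [← h0, Real.zero_rpow (by norm_num), Real.zero_rpow (by linarith)]
      · exact Real.rpow_le_rpow_of_exponent_ge h0 hv (by simpa using hβ2)
    have := Real.rpow_nonneg (abs_nonneg v) β
    linarith
  · have h1 := norm_exp_I_mul_ofReal_sub_one_sub_le v
    have h2 : |v| ≤ |v| ^ β := Real.self_le_rpow_of_one_le hv hβ1
    linarith

lemma norm_one_sub_exp_neg_le {z : ℂ} (hz : 0 ≤ z.re) : ‖1 - Complex.exp (-z)‖ ≤ ‖z‖ := by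
  have h := Convex.norm_image_sub_le_of_norm_deriv_le (𝕜 := ℂ) (f := Complex.exp)
    (s := {w : ℂ | w.re ≤ 0}) (x := -z) (y := 0) (C := 1)
    (fun x _ => Complex.differentiableAt_exp)
    (fun x hx => by simpa [Complex.norm_exp] using hx)
    (convex_halfSpace_re_le 0) (by simpa using hz) (by simp)
  simpa using h

lemma one_sub_cos_le_min (b : ℝ) : 1 - Real.cos b ≤ min 2 (b ^ 2) := by
  refine le_min (by linarith [Real.neg_one_le_cos b]) ?_
  nlinarith [Real.one_sub_sq_div_two_le_cos (x := b), sq_nonneg b]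

lemma one_sub_re_exp_neg_le {z : ℂ} (hz : 0 ≤ z.re) :
    1 - (Complex.exp (-z)).re ≤ z.re + min 2 (z.im ^ 2) := by
  rw [Complex.exp_re]
  simp only [Complex.neg_re, Complex.neg_im, Real.cos_neg]
  have h1 := Real.add_one_le_exp (-z.re)
  have h2 : Real.exp (-z.re) ≤ 1 := Real.exp_le_one_iff.2 (by linarith)
  have h3 := one_sub_cos_le_min z.im
  nlinarith [Real.cos_le_one z.im, Real.exp_pos (-z.re)]

lemma tendsto_inv_mul_one_sub_exp_neg_mul (z : ℂ) :
    Tendsto (fun t : ℝ => ((t⁻¹ : ℝ) : ℂ) * (1 - Complex.exp (-(t : ℂ) * z))) (𝓝[>] 0) (𝓝 z) := by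
  have h : HasDerivAt (fun t : ℝ => -Complex.exp (-(t : ℂ) * z)) z 0 := by
    have h1 : HasDerivAt (fun t : ℝ => -(t : ℂ) * z) (-1 * z) 0 :=
      ((Complex.ofRealCLM.hasDerivAt (x := (0 : ℝ))).neg).mul_const z
    simpa using h1.cexp.fun_neg
  have h2 := h.tendsto_slope_zero_right
  refine h2.congr fun t => ?_
  simp
  ring

lemma norm_inv_mul_one_sub_exp_neg_mul_le {z : ℂ} (hz : 0 ≤ z.re) {t : ℝ} (ht : 0 < t) :
    ‖((t⁻¹ : ℝ) : ℂ) * (1 - Complex.exp (-(t : ℂ) * z))‖ ≤ ‖z‖ := by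
  have h : ‖1 - Complex.exp (-((t : ℂ) * z))‖ ≤ ‖(t : ℂ) * z‖ :=
    norm_one_sub_exp_neg_le (by simpa using mul_nonneg ht.le hz)
  rw [norm_mul, Complex.norm_real, Real.norm_eq_abs, abs_of_pos (inv_pos.2 ht), neg_mul]
  rw [norm_mul, Complex.norm_real, Real.norm_eq_abs, abs_of_pos ht] at h
  rw [inv_mul_le_iff₀ ht]
  exact h

lemma exp_I_mul_mul_one_sub_cos (a b : ℝ) :
    Complex.exp (Complex.I * (a : ℂ)) * ((1 - Real.cos b : ℝ) : ℂ)
      = Complex.exp (Complex.I * (a : ℂ)) - (Complex.exp (Complex.I * ((a : ℂ) + b))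
        + Complex.exp (Complex.I * ((a : ℂ) - b))) / 2 := by
  have h1 : Complex.I * ((a : ℂ) + b) = Complex.I * a + b * Complex.I := by ring
  have h2 : Complex.I * ((a : ℂ) - b) = Complex.I * a + -b * Complex.I := by ring
  rw [h1, h2, Complex.exp_add, Complex.exp_add, Complex.ofReal_sub, Complex.ofReal_one,
    Complex.ofReal_cos, Complex.cos]
  ring

/-! ### Lévy's continuity theorem for finite measures -/

section FiniteLevy

variable {E : Type*} [NormedAddCommGroup E] [InnerProductSpace ℝ E] [FiniteDimensional ℝ E]
  [MeasurableSpace E] [BorelSpace E]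

/-- The probability measure proportional to `μ + δ₀`. -/
noncomputable def normalizedAddDirac (μ : Measure E) [IsFiniteMeasure μ] : ProbabilityMeasure E :=
  ⟨((μ + Measure.dirac 0 : Measure E) Set.univ)⁻¹ • (μ + Measure.dirac 0), by
    have : NeZero (μ + Measure.dirac (0 : E)) := ⟨by
      intro h
      have := congrArg (fun m : Measure E => m Set.univ) h
      simp at this⟩
    infer_instance⟩

lemma integral_normalizedAddDirac {G : Type*} [NormedAddCommGroup G] [NormedSpace ℝ G]
    [CompleteSpace G] (μ : Measure E) [IsFiniteMeasure μ] {g : E → G} (hg : Integrable g μ) :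
    ∫ x, g x ∂(normalizedAddDirac μ : Measure E)
      = (μ.real Set.univ + 1)⁻¹ • (∫ x, g x ∂μ + g 0) := by
  have h : (normalizedAddDirac μ : Measure E)
    = ((μ + Measure.dirac 0 : Measure E) Set.univ)⁻¹ • (μ + Measure.dirac 0) := rfl
  rw [h, integral_smul_measure, integral_add_measure hg (integrable_dirac (by simp)), integral_dirac]
  congr 1
  simp [ENNReal.toReal_inv, ENNReal.toReal_add, Measure.real]

lemma tendsto_integral_of_tendsto_charFun {μ : ℕ → Measure E} [∀ n, IsFiniteMeasure (μ n)]
    {μ₀ : Measure E} [IsFiniteMeasure μ₀]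
    (h : ∀ ξ, Tendsto (fun n => charFun (μ n) ξ) atTop (𝓝 (charFun μ₀ ξ)))
    (g : BoundedContinuousFunction E ℝ) :
    Tendsto (fun n => ∫ x, g x ∂(μ n)) atTop (𝓝 (∫ x, g x ∂μ₀)) := by
  have hmass : Tendsto (fun n => (μ n).real Set.univ + 1) atTop (𝓝 (μ₀.real Set.univ + 1)) := by
    have := (h 0)
    simp only [charFun_zero] at this
    exact ((Complex.continuous_re.tendsto _).comp this).add_const 1
  have hpos (m : Measure E) : m.real Set.univ + 1 ≠ 0 := by positivity
  have hchar (m : Measure E) [IsFiniteMeasure m] (ξ : E) :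
      charFun (normalizedAddDirac m : Measure E) ξ
        = (m.real Set.univ + 1)⁻¹ • (charFun m ξ + 1) := by
    simp only [charFun_apply]
    rw [integral_normalizedAddDirac]
    · simp
    · refine Integrable.of_bound (by fun_prop) 1 (Eventually.of_forall fun x => ?_)
      rw [Complex.norm_exp_ofReal_mul_I]
  have hconv : Tendsto (fun n => normalizedAddDirac (μ n)) atTop (𝓝 (normalizedAddDirac μ₀)) := by
    rw [ProbabilityMeasure.tendsto_iff_tendsto_charFun]
    intro ξ
    simp only [hchar]
    exact (hmass.inv₀ (hpos _)).smul ((h ξ).add_const 1)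
  rw [ProbabilityMeasure.tendsto_iff_forall_integral_tendsto] at hconv
  have hg := hconv g
  have hint (m : Measure E) [IsFiniteMeasure m] : ∫ x, g x ∂m
      = (m.real Set.univ + 1) * ∫ x, g x ∂(normalizedAddDirac m : Measure E) - g 0 := by
    rw [integral_normalizedAddDirac m (g.integrable m), smul_eq_mul, mul_inv_cancel_left₀ (hpos m)]
    ring
  rw [hint μ₀]
  refine Tendsto.congr (fun n => (hint (μ n)).symm) ?_
  exact (hmass.mul hg).sub_const _

end FiniteLevy

/-! ### The characteristic exponent -/

section Exponent

variable {E : Type*} [NormedAddCommGroup E] [InnerProductSpace ℝ E] [FiniteDimensional ℝ E]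
  [MeasurableSpace E] [BorelSpace E]

/-- The integrand of the Lévy–Khintchine formula. -/
noncomputable def levyKernel (ξ y : E) : ℂ :=
  Complex.exp (Complex.I * (⟪ξ, y⟫ : ℂ)) - 1 - Complex.I * (if ‖y‖ ≤ 1 then (⟪ξ, y⟫ : ℂ) else 0)

/-- The characteristic exponent of a Lévy process without Gaussian part. -/
noncomputable def levyExponent (γ : E) (ν : Measure E) (ξ : E) : ℂ :=
  -Complex.I * (⟪ξ, γ⟫ : ℂ) - ∫ y, levyKernel ξ y ∂ν

omit [FiniteDimensional ℝ E] in
lemma measurable_levyKernel [SecondCountableTopology E] (ξ : E) : Measurable (levyKernel ξ) := by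
  unfold levyKernel
  refine Measurable.sub (by fun_prop) (Measurable.const_mul ?_ _)
  exact Measurable.ite (measurableSet_le measurable_norm measurable_const) (by fun_prop)
    measurable_const

omit [FiniteDimensional ℝ E] [MeasurableSpace E] [BorelSpace E] in
lemma abs_inner_rpow_le {β : ℝ} (hβ : 0 ≤ β) (ξ y : E) :
    |⟪ξ, y⟫| ^ β ≤ ‖ξ‖ ^ β * ‖y‖ ^ β := by
  rw [← Real.mul_rpow (norm_nonneg _) (norm_nonneg _)]
  exact Real.rpow_le_rpow (abs_nonneg _) (abs_real_inner_le_norm ξ y) hβ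

omit [FiniteDimensional ℝ E] [MeasurableSpace E] [BorelSpace E] in
lemma norm_levyKernel_le {β : ℝ} (hβ1 : 1 ≤ β) (hβ2 : β ≤ 2) (ξ y : E) :
    ‖levyKernel ξ y‖ ≤ 3 * (1 + ‖ξ‖ ^ β) * min 1 (‖y‖ ^ β) := by
  have hξ : 0 ≤ ‖ξ‖ ^ β := by positivity
  unfold levyKernel
  split_ifs with hy
  · rw [min_eq_right (Real.rpow_le_one (norm_nonneg y) hy (by linarith))]
    have hyβ : 0 ≤ ‖y‖ ^ β := by positivity
    refine (norm_exp_I_mul_ofReal_sub_one_sub_le_rpow hβ1 hβ2 _).trans ?_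
    have := abs_inner_rpow_le (by linarith) ξ y (β := β)
    nlinarith
  · rw [min_eq_left (Real.one_le_rpow (not_le.1 hy).le (by linarith)), mul_zero, sub_zero]
    refine (norm_sub_le _ _).trans ?_
    rw [Complex.norm_exp_I_mul_ofReal, norm_one]
    linarith

omit [FiniteDimensional ℝ E] [MeasurableSpace E] [BorelSpace E] in
lemma norm_exp_I_mul_inner_sub_one_le {β : ℝ} (hβ0 : 0 ≤ β) (hβ1 : β ≤ 1) (ξ y : E) :
    ‖Complex.exp (Complex.I * (⟪ξ, y⟫ : ℂ)) - 1‖ ≤ 2 * (1 + ‖ξ‖ ^ β) * min 1 (‖y‖ ^ β) := by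
  have hξ : 0 ≤ ‖ξ‖ ^ β := by positivity
  rcases le_total ‖y‖ 1 with hy | hy
  · rw [min_eq_right (Real.rpow_le_one (norm_nonneg y) hy hβ0)]
    have hyβ : 0 ≤ ‖y‖ ^ β := by positivity
    refine (norm_exp_I_mul_ofReal_sub_one_le_rpow hβ0 hβ1 _).trans ?_
    have := abs_inner_rpow_le hβ0 ξ y
    nlinarith
  · rw [min_eq_left (Real.one_le_rpow hy hβ0)]
    refine (norm_sub_le _ _).trans ?_
    rw [Complex.norm_exp_I_mul_ofReal, norm_one]
    linarith

omit [FiniteDimensional ℝ E] [MeasurableSpace E] [BorelSpace E] in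
lemma one_sub_cos_inner_le (ξ y : E) :
    1 - Real.cos ⟪ξ, y⟫ ≤ 2 * (1 + ‖ξ‖ ^ 2) * min 1 (‖y‖ ^ (2 : ℝ)) := by
  have h := one_sub_cos_le_min ⟪ξ, y⟫
  have hξ : 0 ≤ ‖ξ‖ ^ 2 := by positivity
  rw [Real.rpow_two]
  rcases le_total (‖y‖ ^ 2) 1 with hy | hy
  · rw [min_eq_right hy]
    have h1 : ⟪ξ, y⟫ ^ 2 ≤ ‖ξ‖ ^ 2 * ‖y‖ ^ 2 := by
      rw [← mul_pow, ← sq_abs]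
      exact pow_le_pow_left₀ (abs_nonneg _) (abs_real_inner_le_norm ξ y) 2
    have := h.trans (min_le_right _ _)
    nlinarith [sq_nonneg ‖y‖]
  · rw [min_eq_left hy]
    have := h.trans (min_le_left _ _)
    linarith

variable {ν : Measure E}

omit [InnerProductSpace ℝ E] [FiniteDimensional ℝ E] in
lemma integrable_min_one_rpow_mono {α β : ℝ} (hα : 0 ≤ α) (hαβ : α ≤ β) (hβ : 0 < β)
    (h : Integrable (fun y : E => min 1 (‖y‖ ^ α)) ν) :
    Integrable (fun y : E => min 1 (‖y‖ ^ β)) ν := by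
  refine h.mono' (by fun_prop (disch := exact hβ.le)) (Eventually.of_forall fun y => ?_)
  rw [Real.norm_of_nonneg (by positivity)]
  rcases le_total ‖y‖ 1 with hy | hy
  · refine min_le_min_left _ ?_
    rcases (norm_nonneg y).eq_or_lt with h0 | h0
    · rw [← h0, Real.zero_rpow hβ.ne']
      positivity
    · exact Real.rpow_le_rpow_of_exponent_ge h0 hy hαβ
  · rw [min_eq_left (Real.one_le_rpow hy hα)]
    exact min_le_left _ _

lemma integrable_levyKernel (hν : Integrable (fun y : E => min 1 (‖y‖ ^ (2 : ℝ))) ν) (ξ : E) :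
    Integrable (levyKernel ξ) ν :=
  (hν.const_mul (3 * (1 + ‖ξ‖ ^ (2 : ℝ)))).mono' (measurable_levyKernel ξ).aestronglyMeasurable
    (Eventually.of_forall fun y => norm_levyKernel_le one_le_two le_rfl ξ y)

lemma levyExponent_re (hν : Integrable (fun y : E => min 1 (‖y‖ ^ (2 : ℝ))) ν) (γ ξ : E) :
    (levyExponent γ ν ξ).re = ∫ y, (1 - Real.cos ⟪ξ, y⟫) ∂ν := by
  have h : (∫ y, levyKernel ξ y ∂ν).re = ∫ y, (levyKernel ξ y).re ∂ν :=
    (integral_re (integrable_levyKernel hν ξ)).symm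
  rw [levyExponent, Complex.sub_re, h]
  have h1 : (-Complex.I * (⟪ξ, γ⟫ : ℂ)).re = 0 := by simp
  rw [h1, zero_sub, ← integral_neg]
  refine integral_congr_ae (Eventually.of_forall fun y => ?_)
  simp only [levyKernel]
  rw [mul_comm Complex.I, mul_comm Complex.I]
  split_ifs <;> simp [Complex.exp_ofReal_mul_I_re]

lemma levyExponent_re_nonneg (hν : Integrable (fun y : E => min 1 (‖y‖ ^ (2 : ℝ))) ν) (γ ξ : E) :
    0 ≤ (levyExponent γ ν ξ).re := by
  rw [levyExponent_re hν]
  exact integral_nonneg fun y => by simpa using Real.cos_le_one _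

omit [FiniteDimensional ℝ E] [BorelSpace E] in
lemma norm_levyExponent_le {β : ℝ} (hβ1 : 1 ≤ β) (hβ2 : β ≤ 2)
    (hν : Integrable (fun y : E => min 1 (‖y‖ ^ β)) ν) (γ ξ : E) :
    ‖levyExponent γ ν ξ‖ ≤ ‖ξ‖ * ‖γ‖ + 3 * (1 + ‖ξ‖ ^ β) * ∫ y, min 1 (‖y‖ ^ β) ∂ν := by
  refine (norm_sub_le _ _).trans (add_le_add ?_ ?_)
  · simpa using abs_real_inner_le_norm ξ γ
  · rw [← integral_const_mul]
    exact norm_integral_le_of_norm_le (hν.const_mul _)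
      (Eventually.of_forall fun y => norm_levyKernel_le hβ1 hβ2 ξ y)

lemma levyExponent_second_difference
    (hν : Integrable (fun y : E => min 1 (‖y‖ ^ (2 : ℝ))) ν) (γ ξ η : E) :
    (levyExponent γ ν (η + ξ) + levyExponent γ ν (η - ξ)) / 2 - levyExponent γ ν η
      = ∫ y, Complex.exp (Complex.I * (⟪η, y⟫ : ℂ)) * ((1 - Real.cos ⟪ξ, y⟫ : ℝ) : ℂ) ∂ν := by
  have hi := fun ζ : E => integrable_levyKernel hν ζ
  have h : ∀ y, Complex.exp (Complex.I * (⟪η, y⟫ : ℂ)) * ((1 - Real.cos ⟪ξ, y⟫ : ℝ) : ℂ)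
      = levyKernel η y - (levyKernel (η + ξ) y + levyKernel (η - ξ) y) / 2 := by
    intro y
    rw [exp_I_mul_mul_one_sub_cos]
    simp only [levyKernel, inner_add_left, inner_sub_left, Complex.ofReal_add, Complex.ofReal_sub]
    split_ifs <;> ring
  simp_rw [h]
  rw [integral_sub (hi _) (by exact ((hi _).add (hi _)).div_const 2), integral_div,
    integral_add (hi _) (hi _)]
  simp only [levyExponent, inner_add_left, inner_sub_left, Complex.ofReal_add, Complex.ofReal_sub]
  ring

lemma sigmaFinite_of_integrable_min_one_rpow (hν0 : ν {0} = 0)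
    (hν : Integrable (fun y : E => min 1 (‖y‖ ^ (2 : ℝ))) ν) : SigmaFinite ν := by
  set f : E → ℝ≥0∞ := fun y => ENNReal.ofReal (min 1 (‖y‖ ^ (2 : ℝ))) with hf
  have hfm : Measurable f := by fun_prop
  have hne : ∀ᵐ y ∂ν, f y ≠ 0 := by
    have : ∀ᵐ y ∂ν, y ≠ 0 := by
      rw [ae_iff]; simpa using hν0
    filter_upwards [this] with y hy
    have : 0 < ‖y‖ := norm_pos_iff.2 hy
    simp only [hf, ne_eq, ENNReal.ofReal_eq_zero, not_le]
    positivity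
  have hfin : IsFiniteMeasure (ν.withDensity f) := by
    refine isFiniteMeasure_withDensity ?_
    have := hν.lintegral_lt_top
    exact this.ne
  rw [← withDensity_inv_same hfm hne (Eventually.of_forall fun _ => ENNReal.ofReal_ne_top)]
  refine SigmaFinite.withDensity_of_ne_top ?_
  rw [ae_withDensity_iff hfm]
  exact Eventually.of_forall fun y hy => ENNReal.inv_ne_top.2 hy

/-- The compensator cancels the drift when `γ = ∫_{‖y‖ ≤ 1} y ν(dy)`. -/
lemma levyExponent_of_drift_eq_zero {β : ℝ} (hβ0 : 0 ≤ β) (hβ1 : β ≤ 1)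
    (hν : Integrable (fun y : E => min 1 (‖y‖ ^ β)) ν) {γ : E}
    (hγ : γ = ∫ y in {y : E | ‖y‖ ≤ 1}, y ∂ν) (ξ : E) :
    levyExponent γ ν ξ = -∫ y, (Complex.exp (Complex.I * (⟪ξ, y⟫ : ℂ)) - 1) ∂ν := by
  have hS : MeasurableSet {y : E | ‖y‖ ≤ 1} := measurableSet_le measurable_norm measurable_const
  have hid : Integrable (fun y : E => {y : E | ‖y‖ ≤ 1}.indicator (fun z => z) y) ν := by
    refine hν.mono' ((measurable_id.indicator hS).aestronglyMeasurable)
      (Eventually.of_forall fun y => ?_)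
    by_cases hy : ‖y‖ ≤ 1
    · rw [Set.indicator_of_mem (by exact hy),
        min_eq_right (Real.rpow_le_one (norm_nonneg y) hy hβ0)]
      exact Real.self_le_rpow_of_le_one (norm_nonneg y) hy hβ1
    · rw [Set.indicator_of_notMem (by exact hy), norm_zero]
      positivity
  have hexp : Integrable (fun y : E => Complex.exp (Complex.I * (⟪ξ, y⟫ : ℂ)) - 1) ν :=
    (hν.const_mul (2 * (1 + ‖ξ‖ ^ β))).mono' (by fun_prop)
      (Eventually.of_forall fun y => norm_exp_I_mul_inner_sub_one_le hβ0 hβ1 ξ y)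
  have hinner : (⟪ξ, γ⟫ : ℂ) = ∫ y, (if ‖y‖ ≤ 1 then (⟪ξ, y⟫ : ℂ) else 0) ∂ν := by
    rw [hγ, ← integral_indicator hS, ← integral_inner hid, ← integral_complex_ofReal]
    refine integral_congr_ae (Eventually.of_forall fun y => ?_)
    by_cases hy : ‖y‖ ≤ 1 <;> simp [Set.indicator, hy]
  have hintI : Integrable (fun y : E => Complex.I * (if ‖y‖ ≤ 1 then (⟪ξ, y⟫ : ℂ) else 0)) ν := by
    refine Integrable.const_mul ?_ _
    refine ((hid.const_inner (𝕜 := ℝ) ξ).ofReal (𝕜 := ℂ)).congr (Eventually.of_forall fun y => ?_)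
    by_cases hy : ‖y‖ ≤ 1 <;> simp [Set.indicator, hy]
  simp only [levyExponent, levyKernel]
  rw [integral_sub hexp hintI, integral_const_mul, ← hinner]
  ring

end Exponent

/-! ### Convergence away from the origin -/

section AwayFromZero

variable {E : Type*} [NormedAddCommGroup E] [InnerProductSpace ℝ E] [FiniteDimensional ℝ E]
  [MeasurableSpace E] [BorelSpace E]

open ProbabilityTheory

lemma integral_one_sub_cos_inner_stdGaussian (x : E) :
    ∫ ξ, (1 - Real.cos ⟪ξ, x⟫) ∂(stdGaussian E) = 1 - Real.exp (-‖x‖ ^ 2 / 2) := by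
  have hcos : Integrable (fun ξ : E => Real.cos ⟪ξ, x⟫) (stdGaussian E) :=
    Integrable.of_bound (by fun_prop) 1 (Eventually.of_forall fun ξ => Real.abs_cos_le_one _)
  have hexp : Integrable (fun ξ : E => Complex.exp (⟪ξ, x⟫ * Complex.I)) (stdGaussian E) :=
    Integrable.of_bound (by fun_prop) 1
      (Eventually.of_forall fun ξ => (Complex.norm_exp_ofReal_mul_I _).le)
  have h := congrArg Complex.re (charFun_stdGaussian x)
  rw [charFun_apply] at h
  have h2 : (∫ ξ, Complex.exp (⟪ξ, x⟫ * Complex.I) ∂(stdGaussian E)).re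
      = ∫ ξ, (Complex.exp (⟪ξ, x⟫ * Complex.I)).re ∂(stdGaussian E) := (integral_re hexp).symm
  rw [h2] at h
  simp only [Complex.exp_ofReal_mul_I_re] at h
  rw [integral_sub (integrable_const _) hcos, h]
  have h3 : (-(‖x‖ : ℂ) ^ 2 / 2) = ((-‖x‖ ^ 2 / 2 : ℝ) : ℂ) := by push_cast; ring
  rw [h3, Complex.exp_ofReal_re]
  simp

lemma integrable_sq_norm_stdGaussian : Integrable (fun ξ : E => ‖ξ‖ ^ 2) (stdGaussian E) :=
  (IsGaussian.memLp_id (stdGaussian E) 2 (by simp)).integrable_norm_pow (by norm_num)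

lemma integral_exp_mul_one_sub_exp {ρ : Measure E} [SFinite ρ]
    (hρ : Integrable (fun y : E => min 1 (‖y‖ ^ (2 : ℝ))) ρ) (η : E) :
    ∫ y, Complex.exp (Complex.I * (⟪η, y⟫ : ℂ)) * ((1 - Real.exp (-‖y‖ ^ 2 / 2) : ℝ) : ℂ) ∂ρ
      = ∫ ξ, ∫ y, Complex.exp (Complex.I * (⟪η, y⟫ : ℂ)) * ((1 - Real.cos ⟪ξ, y⟫ : ℝ) : ℂ) ∂ρ
        ∂(stdGaussian E) := by
  rw [integral_integral_swap]
  · refine integral_congr_ae (Eventually.of_forall fun y => ?_)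
    simp only
    rw [integral_const_mul, integral_complex_ofReal, integral_one_sub_cos_inner_stdGaussian]
  · have hb : Integrable (fun z : E × E => 2 * (1 + ‖z.1‖ ^ 2) * min 1 (‖z.2‖ ^ (2 : ℝ)))
        ((stdGaussian E).prod ρ) :=
      Integrable.mul_prod
        (((integrable_const (1 : ℝ)).add integrable_sq_norm_stdGaussian).const_mul 2) hρ
    refine hb.mono' (by unfold Function.uncurry; fun_prop) (Eventually.of_forall fun z => ?_)
    simp only [Function.uncurry]
    rw [norm_mul, Complex.norm_exp_I_mul_ofReal, one_mul, Complex.norm_real,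
      Real.norm_of_nonneg (by linarith [Real.cos_le_one ⟪z.1, z.2⟫])]
    exact one_sub_cos_inner_le _ _

lemma integrable_min_one_rpow_of_isFiniteMeasure (m : Measure E) [IsFiniteMeasure m] {β : ℝ}
    (hβ : 0 ≤ β) : Integrable (fun y : E => min 1 (‖y‖ ^ β)) m := by
  refine Integrable.of_bound (by fun_prop (disch := exact hβ)) 1 (Eventually.of_forall fun y => ?_)
  rw [Real.norm_of_nonneg (by positivity)]
  exact min_le_left _ _

/-- The measure with density `c (1 - exp (-‖x‖² / 2))`. -/
noncomputable def gaussianWeighted (c : ℝ) (m : Measure E) : Measure E :=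
  m.withDensity fun x => ENNReal.ofReal (c * (1 - Real.exp (-‖x‖ ^ 2 / 2)))

omit [InnerProductSpace ℝ E] [FiniteDimensional ℝ E] [MeasurableSpace E] [BorelSpace E] in
lemma one_sub_exp_neg_sq_nonneg (x : E) : 0 ≤ 1 - Real.exp (-‖x‖ ^ 2 / 2) := by
  have : Real.exp (-‖x‖ ^ 2 / 2) ≤ 1 := Real.exp_le_one_iff.2 (by nlinarith [sq_nonneg ‖x‖])
  linarith

omit [InnerProductSpace ℝ E] [FiniteDimensional ℝ E] [MeasurableSpace E] [BorelSpace E] in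
lemma one_sub_exp_neg_sq_le (x : E) :
    1 - Real.exp (-‖x‖ ^ 2 / 2) ≤ min 1 (‖x‖ ^ (2 : ℝ)) := by
  rw [Real.rpow_two]
  refine le_min (by linarith [Real.exp_pos (-‖x‖ ^ 2 / 2)]) ?_
  have := Real.add_one_le_exp (-‖x‖ ^ 2 / 2)
  nlinarith [sq_nonneg ‖x‖]

omit [InnerProductSpace ℝ E] [FiniteDimensional ℝ E] [BorelSpace E] in
lemma isFiniteMeasure_gaussianWeighted {c : ℝ} (hc : 0 ≤ c) {m : Measure E}
    (hm : Integrable (fun y : E => min 1 (‖y‖ ^ (2 : ℝ))) m) :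
    IsFiniteMeasure (gaussianWeighted c m) := by
  refine isFiniteMeasure_withDensity (ne_of_lt ?_)
  refine lt_of_le_of_lt (lintegral_mono fun x => ?_) (hm.const_mul c).lintegral_lt_top
  exact ENNReal.ofReal_le_ofReal (mul_le_mul_of_nonneg_left (one_sub_exp_neg_sq_le x) hc)

omit [InnerProductSpace ℝ E] [FiniteDimensional ℝ E] in
lemma integral_gaussianWeighted {G : Type*} [NormedAddCommGroup G] [NormedSpace ℝ G]
    {c : ℝ} (hc : 0 ≤ c) (m : Measure E) (g : E → G) :
    ∫ x, g x ∂(gaussianWeighted c m)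
      = c • ∫ x, (1 - Real.exp (-‖x‖ ^ 2 / 2)) • g x ∂m := by
  rw [gaussianWeighted, integral_withDensity_eq_integral_toReal_smul (by fun_prop)
    (Eventually.of_forall fun _ => ENNReal.ofReal_lt_top), ← integral_smul]
  refine integral_congr_ae (Eventually.of_forall fun x => ?_)
  simp only
  rw [ENNReal.toReal_ofReal (mul_nonneg hc (one_sub_exp_neg_sq_nonneg x)), mul_smul]

lemma charFun_gaussianWeighted {c : ℝ} (hc : 0 ≤ c) (m : Measure E) [SFinite m]
    (hm : Integrable (fun y : E => min 1 (‖y‖ ^ (2 : ℝ))) m) (η : E) :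
    charFun (gaussianWeighted c m) η
      = ∫ ξ, (c : ℂ) * ∫ y, Complex.exp (Complex.I * (⟪η, y⟫ : ℂ))
          * ((1 - Real.cos ⟪ξ, y⟫ : ℝ) : ℂ) ∂m ∂(stdGaussian E) := by
  rw [integral_const_mul, ← integral_exp_mul_one_sub_exp hm, charFun_apply,
    integral_gaussianWeighted hc, Complex.real_smul]
  congr 1
  refine integral_congr_ae (Eventually.of_forall fun y => ?_)
  simp only [Complex.real_smul]
  rw [real_inner_comm, mul_comm, mul_comm Complex.I]

lemma integral_exp_mul_one_sub_cos {m : Measure E} [IsFiniteMeasure m] {φ : E → ℂ}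
    (hφ : ∀ ξ, ∫ x, Complex.exp (Complex.I * (⟪ξ, x⟫ : ℂ)) ∂m = φ ξ) (η ξ : E) :
    ∫ y, Complex.exp (Complex.I * (⟪η, y⟫ : ℂ)) * ((1 - Real.cos ⟪ξ, y⟫ : ℝ) : ℂ) ∂m
      = φ η - (φ (η + ξ) + φ (η - ξ)) / 2 := by
  have hi : ∀ ζ : E, Integrable (fun y => Complex.exp (Complex.I * (⟪ζ, y⟫ : ℂ))) m := fun ζ =>
    Integrable.of_bound (by fun_prop) 1
      (Eventually.of_forall fun y => (Complex.norm_exp_I_mul_ofReal _).le)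
  have h : ∀ y, Complex.exp (Complex.I * (⟪η, y⟫ : ℂ)) * ((1 - Real.cos ⟪ξ, y⟫ : ℝ) : ℂ)
      = Complex.exp (Complex.I * (⟪η, y⟫ : ℂ)) - (Complex.exp (Complex.I * (⟪η + ξ, y⟫ : ℂ))
        + Complex.exp (Complex.I * (⟪η - ξ, y⟫ : ℂ))) / 2 := by
    intro y
    rw [exp_I_mul_mul_one_sub_cos, inner_add_left, inner_sub_left, Complex.ofReal_add,
      Complex.ofReal_sub]
  simp_rw [h]
  rw [integral_sub (hi _) (by exact ((hi _).add (hi _)).div_const 2), integral_div,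
    integral_add (hi _) (hi _), hφ, hφ, hφ]

variable {ν : Measure E} {γ : E} {p : ℝ → Measure E}

lemma tendsto_charFun_gaussianWeighted (hν0 : ν {0} = 0)
    (hν : Integrable (fun y : E => min 1 (‖y‖ ^ (2 : ℝ))) ν)
    (hp : ∀ t, 0 < t → IsProbabilityMeasure (p t))
    (hchar : ∀ t, 0 < t → ∀ ξ, ∫ x, Complex.exp (Complex.I * (⟪ξ, x⟫ : ℂ)) ∂(p t)
      = Complex.exp (-(t : ℂ) * levyExponent γ ν ξ)) (η : E) :
    Tendsto (fun t : ℝ => charFun (gaussianWeighted t⁻¹ (p t)) η) (𝓝[>] 0)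
      (𝓝 (charFun (gaussianWeighted 1 ν) η)) := by
  have := sigmaFinite_of_integrable_min_one_rpow hν0 hν
  rw [charFun_gaussianWeighted zero_le_one ν hν]
  set u : ℝ → E → ℂ := fun t ξ => ((t⁻¹ : ℝ) : ℂ) *
    (1 - Complex.exp (-(t : ℂ) * levyExponent γ ν ξ)) with hu
  have hkey : ∀ t, 0 < t → ∀ ξ, ((t⁻¹ : ℝ) : ℂ) * ∫ y, Complex.exp (Complex.I * (⟪η, y⟫ : ℂ))
      * ((1 - Real.cos ⟪ξ, y⟫ : ℝ) : ℂ) ∂(p t) = (u t (η + ξ) + u t (η - ξ)) / 2 - u t η := by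
    intro t ht ξ
    have := hp t ht
    rw [integral_exp_mul_one_sub_cos (hchar t ht)]
    simp only [hu]
    ring
  have hlim : Tendsto (fun t : ℝ => ∫ ξ, ((t⁻¹ : ℝ) : ℂ) * ∫ y, Complex.exp
      (Complex.I * (⟪η, y⟫ : ℂ)) * ((1 - Real.cos ⟪ξ, y⟫ : ℝ) : ℂ) ∂(p t) ∂(stdGaussian E)) (𝓝[>] 0)
      (𝓝 (∫ ξ, ((1 : ℝ) : ℂ) * ∫ y, Complex.exp (Complex.I * (⟪η, y⟫ : ℂ))
        * ((1 - Real.cos ⟪ξ, y⟫ : ℝ) : ℂ) ∂ν ∂(stdGaussian E))) := by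
    set K := ∫ y, min 1 (‖y‖ ^ (2 : ℝ)) ∂ν with hK
    have hK0 : 0 ≤ K := integral_nonneg fun y => by positivity
    have hψ : ∀ ζ : E, ‖levyExponent γ ν ζ‖ ≤ (‖γ‖ + 3 * K) * (1 + ‖ζ‖ ^ 2) := by
      intro ζ
      refine (norm_levyExponent_le one_le_two le_rfl hν γ ζ).trans ?_
      rw [Real.rpow_two]
      nlinarith [mul_nonneg (norm_nonneg γ) (sq_nonneg (‖ζ‖ - 1)),
        mul_nonneg (norm_nonneg γ) (sq_nonneg (‖ζ‖))]
    refine tendsto_integral_filter_of_dominated_convergence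
      (fun ξ => (‖γ‖ + 3 * K) * (4 + 4 * ‖η‖ ^ 2 + 4 * ‖ξ‖ ^ 2)) ?_ ?_ ?_ ?_
    · filter_upwards [self_mem_nhdsWithin] with t ht
      have := hp t ht
      refine AEStronglyMeasurable.const_mul ?_ _
      exact (StronglyMeasurable.integral_prod_right (f := fun (ξ y : E) =>
        Complex.exp (Complex.I * (⟪η, y⟫ : ℂ)) * ((1 - Real.cos ⟪ξ, y⟫ : ℝ) : ℂ)) (by
          apply Measurable.stronglyMeasurable
          unfold Function.uncurry
          fun_prop)).aestronglyMeasurable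
    · filter_upwards [self_mem_nhdsWithin] with t ht
      refine Eventually.of_forall fun ξ => ?_
      rw [hkey t ht]
      have hle : ∀ ζ, ‖u t ζ‖ ≤ (‖γ‖ + 3 * K) * (1 + ‖ζ‖ ^ 2) := fun ζ =>
        (norm_inv_mul_one_sub_exp_neg_mul_le (levyExponent_re_nonneg hν γ ζ) ht).trans (hψ ζ)
      have hn : ‖η + ξ‖ ^ 2 + ‖η - ξ‖ ^ 2 = 2 * (‖η‖ ^ 2 + ‖ξ‖ ^ 2) := by
        have := parallelogram_law_with_norm ℝ η ξ
        nlinarith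
      have h1 := hle (η + ξ)
      have h2 := hle (η - ξ)
      have h3 := hle η
      calc ‖(u t (η + ξ) + u t (η - ξ)) / 2 - u t η‖
          ≤ ‖(u t (η + ξ) + u t (η - ξ)) / 2‖ + ‖u t η‖ := norm_sub_le _ _
        _ ≤ (‖u t (η + ξ)‖ + ‖u t (η - ξ)‖) / 2 + ‖u t η‖ := by
            rw [norm_div, Complex.norm_ofNat]
            gcongr
            exact norm_add_le _ _
        _ ≤ ((‖γ‖ + 3 * K) * (1 + ‖η + ξ‖ ^ 2) + (‖γ‖ + 3 * K) * (1 + ‖η - ξ‖ ^ 2)) / 2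
            + (‖γ‖ + 3 * K) * (1 + ‖η‖ ^ 2) := by gcongr
        _ = (‖γ‖ + 3 * K) * (2 + ‖η‖ ^ 2 + (‖η + ξ‖ ^ 2 + ‖η - ξ‖ ^ 2) / 2) := by ring
        _ ≤ _ := by
            rw [hn]
            refine mul_le_mul_of_nonneg_left ?_ (by positivity)
            nlinarith [sq_nonneg ‖η‖, sq_nonneg ‖ξ‖]
    · exact ((integrable_const _).add (integrable_sq_norm_stdGaussian.const_mul 4)).const_mul _
    · refine Eventually.of_forall fun ξ => ?_
      rw [← levyExponent_second_difference hν γ ξ η, Complex.ofReal_one, one_mul]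
      have hu' : ∀ ζ, Tendsto (fun t => u t ζ) (𝓝[>] 0) (𝓝 (levyExponent γ ν ζ)) := fun ζ =>
        tendsto_inv_mul_one_sub_exp_neg_mul _
      refine Tendsto.congr' ?_ ((((hu' (η + ξ)).add (hu' (η - ξ))).div_const 2).sub (hu' η))
      filter_upwards [self_mem_nhdsWithin] with t ht
      exact (hkey t ht ξ).symm
  refine hlim.congr' ?_
  filter_upwards [self_mem_nhdsWithin] with t ht
  have := hp t ht
  rw [charFun_gaussianWeighted (inv_nonneg.2 (le_of_lt ht)) (p t)
    (integrable_min_one_rpow_of_isFiniteMeasure _ zero_le_two)]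

/-- Convergence against test functions vanishing near the origin. -/
lemma tendsto_inv_mul_integral_of_vanishing (hν0 : ν {0} = 0)
    (hν : Integrable (fun y : E => min 1 (‖y‖ ^ (2 : ℝ))) ν)
    (hp : ∀ t, 0 < t → IsProbabilityMeasure (p t))
    (hchar : ∀ t, 0 < t → ∀ ξ, ∫ x, Complex.exp (Complex.I * (⟪ξ, x⟫ : ℂ)) ∂(p t)
      = Complex.exp (-(t : ℂ) * levyExponent γ ν ξ))
    {G : E → ℝ} (hGc : Continuous G) {M : ℝ} (hGM : ∀ x, |G x| ≤ M) {ε : ℝ} (hε : 0 < ε)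
    (hG0 : ∀ x, ‖x‖ < ε → G x = 0) :
    Tendsto (fun t : ℝ => t⁻¹ * ∫ x, G x ∂(p t)) (𝓝[>] 0) (𝓝 (∫ x, G x ∂ν)) := by
  set w : E → ℝ := fun x => 1 - Real.exp (-‖x‖ ^ 2 / 2) with hw
  set c : ℝ := 1 - Real.exp (-ε ^ 2 / 2) with hc
  have hc0 : 0 < c := by
    have : Real.exp (-ε ^ 2 / 2) < 1 := Real.exp_lt_one_iff.2 (by nlinarith)
    linarith
  have hmax : ∀ x, 0 < max (w x) c := fun x => lt_max_of_lt_right hc0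
  let g : BoundedContinuousFunction E ℝ := BoundedContinuousFunction.ofNormedAddCommGroup
    (fun x => G x / max (w x) c) (hGc.div (by fun_prop) fun x => (hmax x).ne') (M / c) (by
      intro x
      rw [Real.norm_eq_abs, abs_div, abs_of_pos (hmax x)]
      have := (abs_nonneg _).trans (hGM x)
      gcongr
      · exact hGM x
      · exact le_max_right _ _)
  have hg : ∀ x, w x • g x = G x := by
    intro x
    change w x * (G x / max (w x) c) = G x
    rcases lt_or_ge ‖x‖ ε with hx | hx
    · simp [hG0 x hx]
    · have : c ≤ w x := by
        simp only [hw, hc]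
        gcongr
      rw [max_eq_left this, mul_div_cancel₀ _ (hc0.trans_le this).ne']
  have hint : ∀ {s : ℝ} (_ : 0 ≤ s) (m : Measure E),
      ∫ x, g x ∂(gaussianWeighted s m) = s * ∫ x, G x ∂m := by
    intro s hs m
    rw [integral_gaussianWeighted hs m, smul_eq_mul]
    congr 1
    exact integral_congr_ae (Eventually.of_forall hg)
  have hfin : IsFiniteMeasure (gaussianWeighted 1 ν) :=
    isFiniteMeasure_gaussianWeighted zero_le_one hν
  refine tendsto_of_seq_tendsto fun τ hτ => ?_
  have hpos : ∀ᶠ n in atTop, 0 < τ n := hτ.eventually self_mem_nhdsWithin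
  obtain ⟨N, hN⟩ := eventually_atTop.1 hpos
  rw [← tendsto_add_atTop_iff_nat N]
  have hτN : Tendsto (fun n => τ (n + N)) atTop (𝓝[>] 0) :=
    hτ.comp (tendsto_add_atTop_nat N)
  have hpos' : ∀ n, 0 < τ (n + N) := fun n => hN _ (Nat.le_add_left _ _)
  have hfinn : ∀ n, IsFiniteMeasure (gaussianWeighted (τ (n + N))⁻¹ (p (τ (n + N)))) := fun n => by
    have := hp _ (hpos' n)
    exact isFiniteMeasure_gaussianWeighted (inv_nonneg.2 (hpos' n).le)
      (integrable_min_one_rpow_of_isFiniteMeasure _ zero_le_two)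
  have h := tendsto_integral_of_tendsto_charFun
    (μ := fun n => gaussianWeighted (τ (n + N))⁻¹ (p (τ (n + N)))) (μ₀ := gaussianWeighted 1 ν)
    (fun ξ => (tendsto_charFun_gaussianWeighted hν0 hν hp hchar ξ).comp hτN) g
  rw [hint zero_le_one, one_mul] at h
  exact h.congr fun n => hint (inv_nonneg.2 (hpos' n).le) _

end AwayFromZero

/-! ### Growth of the exponent along rays -/

section Growth

variable {E : Type*} [NormedAddCommGroup E] [InnerProductSpace ℝ E] [FiniteDimensional ℝ E]
  [MeasurableSpace E] [BorelSpace E] {ν : Measure E}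

omit [InnerProductSpace ℝ E] [FiniteDimensional ℝ E] [BorelSpace E] in
lemma tendsto_rpow_neg_mul_norm_integral {β A : ℝ} (hβ : 0 < β)
    (hν : Integrable (fun y : E => min 1 (‖y‖ ^ β)) ν) {k : ℝ → E → ℂ}
    (hm : ∀ s, Measurable (k s))
    (hb : ∀ s, 1 ≤ s → ∀ y, ‖k s y‖ ≤ A * (1 + s ^ β) * min 1 (‖y‖ ^ β))
    (hlim : ∀ y, Tendsto (fun s : ℝ => s ^ (-β) * ‖k s y‖) atTop (𝓝 0)) :
    Tendsto (fun s : ℝ => s ^ (-β) * ‖∫ y, k s y ∂ν‖) atTop (𝓝 0) := by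
  have h : Tendsto (fun s : ℝ => ∫ y, s ^ (-β) * ‖k s y‖ ∂ν) atTop (𝓝 (∫ _, (0 : ℝ) ∂ν)) := by
    refine tendsto_integral_filter_of_dominated_convergence
      (fun y => |A| * 2 * min 1 (‖y‖ ^ β)) ?_ ?_ (hν.const_mul _) (Eventually.of_forall hlim)
    · exact Eventually.of_forall fun s => ((hm s).norm.const_mul _).aestronglyMeasurable
    · filter_upwards [eventually_ge_atTop 1] with s hs
      refine Eventually.of_forall fun y => ?_
      have hs0 : 0 < s := by linarith
      have h0 : 0 ≤ s ^ (-β) := by positivity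
      have h1 : s ^ (-β) ≤ 1 := Real.rpow_le_one_of_one_le_of_nonpos hs (by linarith)
      have h2 : s ^ (-β) * s ^ β = 1 := by rw [← Real.rpow_add hs0]; simp
      have hmin : 0 ≤ min 1 (‖y‖ ^ β) := by positivity
      rw [Real.norm_of_nonneg (by positivity)]
      calc s ^ (-β) * ‖k s y‖ ≤ s ^ (-β) * (|A| * (1 + s ^ β) * min 1 (‖y‖ ^ β)) := by
            gcongr
            refine (hb s hs y).trans ?_
            gcongr
            exact le_abs_self A
        _ = |A| * (s ^ (-β) + s ^ (-β) * s ^ β) * min 1 (‖y‖ ^ β) := by ring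
        _ ≤ |A| * 2 * min 1 (‖y‖ ^ β) := by
            rw [h2]
            gcongr
            linarith
  rw [integral_zero] at h
  refine squeeze_zero' ?_ ?_ h
  · filter_upwards [eventually_ge_atTop 0] with s hs
    positivity
  · filter_upwards [eventually_ge_atTop 0] with s hs
    rw [integral_const_mul]
    exact mul_le_mul_of_nonneg_left (norm_integral_le_integral_norm _) (by positivity)

lemma tendsto_rpow_neg_mul_norm_levyExponent {β : ℝ} (hβ0 : 0 < β) (hβ2 : β ≤ 2)
    (hν : Integrable (fun y : E => min 1 (‖y‖ ^ β)) ν) {γ : E}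
    (hγ : β ≤ 1 → γ = ∫ y in {y : E | ‖y‖ ≤ 1}, y ∂ν) {e : E} (he : ‖e‖ = 1) :
    Tendsto (fun s : ℝ => s ^ (-β) * ‖levyExponent γ ν (s • e)‖) atTop (𝓝 0) := by
  have hnorm : ∀ s : ℝ, 1 ≤ s → ‖s • e‖ = s := fun s hs => by
    rw [norm_smul, he, mul_one, Real.norm_of_nonneg (by linarith)]
  have hdecay : ∀ c : ℝ, Tendsto (fun s : ℝ => s ^ (-β) * c) atTop (𝓝 0) := fun c => by
    simpa using (tendsto_rpow_neg_atTop hβ0).mul_const c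
  rcases le_or_gt β 1 with hβ1 | hβ1
  · have hψ : ∀ ξ, ‖levyExponent γ ν ξ‖
        = ‖∫ y, (Complex.exp (Complex.I * (⟪ξ, y⟫ : ℂ)) - 1) ∂ν‖ := fun ξ => by
      rw [levyExponent_of_drift_eq_zero hβ0.le hβ1 hν (hγ hβ1), norm_neg]
    simp only [hψ]
    refine tendsto_rpow_neg_mul_norm_integral (A := 2) hβ0 hν (fun s => by fun_prop) ?_ ?_
    · intro s hs y
      have := norm_exp_I_mul_inner_sub_one_le hβ0.le hβ1 (s • e) y
      rwa [hnorm s hs] at this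
    · intro y
      refine squeeze_zero' ?_ ?_ (hdecay 2)
      · filter_upwards [eventually_ge_atTop 0] with s hs
        positivity
      · filter_upwards [eventually_ge_atTop 0] with s hs
        gcongr
        refine (norm_sub_le _ _).trans ?_
        rw [Complex.norm_exp_I_mul_ofReal, norm_one]
        norm_num
  · have hdecay1 : ∀ c : ℝ, Tendsto (fun s : ℝ => s ^ (-β) * (s * c)) atTop (𝓝 0) := fun c => by
      have h := (tendsto_rpow_neg_atTop (sub_pos.2 hβ1)).mul_const c
      rw [zero_mul] at h
      refine h.congr' ?_
      filter_upwards [eventually_gt_atTop 0] with s hs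
      rw [← mul_assoc]
      nth_rewrite 3 [← Real.rpow_one s]
      rw [← Real.rpow_add hs]
      congr 2
      ring
    have hker := tendsto_rpow_neg_mul_norm_integral (k := fun s => levyKernel (s • e)) (A := 3) hβ0
      hν (fun s => measurable_levyKernel _) (by
        intro s hs y
        have := norm_levyKernel_le hβ1.le hβ2 (s • e) y
        rwa [hnorm s hs] at this) (by
        intro y
        have hsum := (hdecay 2).add (hdecay1 ‖y‖)
        rw [add_zero] at hsum
        refine squeeze_zero' ?_ ?_ hsum
        · filter_upwards [eventually_ge_atTop 0] with s hs
          positivity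
        · filter_upwards [eventually_ge_atTop 1] with s hs
          rw [← mul_add]
          gcongr
          have hin : |⟪s • e, y⟫| ≤ s * ‖y‖ := by
            simpa [hnorm s hs] using abs_real_inner_le_norm (s • e) y
          unfold levyKernel
          split_ifs
          · exact (norm_exp_I_mul_ofReal_sub_one_sub_le _).trans (by linarith)
          · rw [mul_zero, sub_zero]
            refine (norm_sub_le _ _).trans ?_
            rw [Complex.norm_exp_I_mul_ofReal, norm_one]
            linarith [(abs_nonneg _).trans hin])
    have hsum := (hdecay1 ‖γ‖).add hker
    rw [add_zero] at hsum
    refine squeeze_zero' ?_ ?_ hsum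
    · filter_upwards [eventually_ge_atTop 0] with s hs
      positivity
    · filter_upwards [eventually_ge_atTop 1] with s hs
      rw [← mul_add]
      gcongr
      refine (norm_sub_le _ _).trans (add_le_add ?_ le_rfl)
      simpa [hnorm s hs] using abs_real_inner_le_norm (s • e) γ

end Growth

/-! ### One-dimensional weights -/

section Weights

open Set

lemma lintegral_Ioi_two_mul_rpow {β : ℝ} (hβ : 0 < β) {c : ℝ} (hc : 0 < c) :
    ∫⁻ s in Ioi c, ENNReal.ofReal (2 * s ^ (-1 - β)) = ENNReal.ofReal (2 / β * c ^ (-β)) := by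
  have hi : IntegrableOn (fun s : ℝ => 2 * s ^ (-1 - β)) (Ioi c) :=
    (integrableOn_Ioi_rpow_of_lt (by linarith) hc).const_mul 2
  rw [← ofReal_integral_eq_lintegral_ofReal hi, integral_const_mul,
    integral_Ioi_rpow_of_lt (by linarith) hc]
  · congr 1
    rw [show -1 - β + 1 = -β by ring]
    field_simp
  · refine (ae_restrict_iff' measurableSet_Ioi).2 (Eventually.of_forall fun s hs => ?_)
    have : 0 < s := hc.trans hs
    positivity

lemma lintegral_min_two_rpow_le {α β : ℝ} (hβ : 0 < β) (hαβ : β < α) {b : ℝ} (hb : 0 ≤ b) :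
    ∫⁻ s in Ioi (0 : ℝ), ENNReal.ofReal (min 2 ((b * s) ^ α) * s ^ (-1 - β))
      ≤ ENNReal.ofReal ((1 / (α - β) + 2 / β) * b ^ β) := by
  have hα : 0 < α := hβ.trans hαβ
  have hαβ' : 0 < α - β := sub_pos.2 hαβ
  rcases hb.eq_or_lt with rfl | hb
  · simp [Real.zero_rpow hα.ne']
  have hc : 0 < b⁻¹ := inv_pos.2 hb
  have hsplit : Ioi (0 : ℝ) = Ioc 0 b⁻¹ ∪ Ioi b⁻¹ := (Ioc_union_Ioi_eq_Ioi hc.le).symm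
  rw [hsplit]
  refine (lintegral_union_le _ _ _).trans ?_
  rw [add_mul, ENNReal.ofReal_add (by positivity) (by positivity)]
  refine add_le_add ?_ ?_
  · have hi : IntegrableOn (fun s : ℝ => b ^ α * s ^ (α - 1 - β)) (Ioc 0 b⁻¹) :=
      ((intervalIntegrable_iff_integrableOn_Ioc_of_le hc.le).1
        (intervalIntegral.intervalIntegrable_rpow' (by linarith))).const_mul _
    calc ∫⁻ s in Ioc 0 b⁻¹, ENNReal.ofReal (min 2 ((b * s) ^ α) * s ^ (-1 - β))
        ≤ ∫⁻ s in Ioc 0 b⁻¹, ENNReal.ofReal (b ^ α * s ^ (α - 1 - β)) := by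
          refine setLIntegral_mono' measurableSet_Ioc fun s hs => ENNReal.ofReal_le_ofReal ?_
          have hs0 : 0 < s := hs.1
          calc min 2 ((b * s) ^ α) * s ^ (-1 - β) ≤ (b * s) ^ α * s ^ (-1 - β) := by
                gcongr
                exact min_le_right _ _
            _ = b ^ α * s ^ (α - 1 - β) := by
                rw [Real.mul_rpow hb.le hs0.le, mul_assoc, ← Real.rpow_add hs0]
                congr 2
                ring
      _ = ENNReal.ofReal (∫ s in Ioc 0 b⁻¹, b ^ α * s ^ (α - 1 - β)) := by
          rw [ofReal_integral_eq_lintegral_ofReal hi]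
          refine (ae_restrict_iff' measurableSet_Ioc).2 (Eventually.of_forall fun s hs => ?_)
          have : 0 < s := hs.1
          positivity
      _ ≤ ENNReal.ofReal (1 / (α - β) * b ^ β) := by
          refine le_of_eq ?_
          rw [integral_const_mul, ← intervalIntegral.integral_of_le hc.le,
            integral_rpow (Or.inl (by linarith)), show α - 1 - β + 1 = α - β by ring,
            Real.zero_rpow hαβ'.ne', sub_zero, Real.inv_rpow hb.le, ← Real.rpow_neg hb.le,
            mul_div_assoc', ← Real.rpow_add hb]
          rw [show α + -(α - β) = β by ring]
          congr 1
          ring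
  · calc ∫⁻ s in Ioi b⁻¹, ENNReal.ofReal (min 2 ((b * s) ^ α) * s ^ (-1 - β))
        ≤ ∫⁻ s in Ioi b⁻¹, ENNReal.ofReal (2 * s ^ (-1 - β)) := by
          refine setLIntegral_mono' measurableSet_Ioi fun s hs => ENNReal.ofReal_le_ofReal ?_
          have hs0 : 0 < s := hc.trans hs
          gcongr
          exact min_le_left _ _
      _ = ENNReal.ofReal (2 / β * b ^ β) := by
          rw [lintegral_Ioi_two_mul_rpow hβ hc, Real.inv_rpow hb.le, Real.rpow_neg hb.le, inv_inv]

/-- The tail weight `∫_R^∞ (1 - cos (s u)) s^{-1-β} ds`. -/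
noncomputable def cosWeight (β R u : ℝ) : ℝ≥0∞ :=
  ∫⁻ s in Ioi R, ENNReal.ofReal ((1 - Real.cos (s * u)) * s ^ (-1 - β))

lemma cosWeight_le_rpow_neg {β : ℝ} (hβ : 0 < β) {R : ℝ} (hR : 0 < R) (u : ℝ) :
    cosWeight β R u ≤ ENNReal.ofReal (2 / β * R ^ (-β)) := by
  rw [← lintegral_Ioi_two_mul_rpow hβ hR]
  refine setLIntegral_mono' measurableSet_Ioi fun s hs => ENNReal.ofReal_le_ofReal ?_
  have hs0 : 0 < s := hR.trans hs
  gcongr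
  linarith [Real.neg_one_le_cos (s * u)]

lemma cosWeight_le_abs_rpow {β : ℝ} (hβ : 0 < β) (hβ2 : β < 2) {R : ℝ} (hR : 0 ≤ R) (u : ℝ) :
    cosWeight β R u ≤ ENNReal.ofReal ((1 / (2 - β) + 2 / β) * |u| ^ β) := by
  refine le_trans ?_ (lintegral_min_two_rpow_le hβ hβ2 (abs_nonneg u))
  refine (lintegral_mono_set (Ioi_subset_Ioi hR)).trans ?_
  refine setLIntegral_mono' measurableSet_Ioi fun s hs => ENNReal.ofReal_le_ofReal ?_
  have hs0 : (0 : ℝ) < s := hs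
  gcongr
  have h := one_sub_cos_le_min (s * u)
  rwa [Real.rpow_two, mul_pow, sq_abs, ← mul_pow, mul_comm u s]

lemma abs_rpow_le_cosWeight {β : ℝ} (hβ : 0 < β) {R : ℝ} (hR : 0 < R) {u : ℝ} (hu : |u| ≤ R⁻¹ / 2) :
    ENNReal.ofReal (4 / 9 * 2 ^ (-1 - β) * |u| ^ β) ≤ cosWeight β R u := by
  rcases (abs_nonneg u).eq_or_lt with h0 | h0
  · simp [← h0, Real.zero_rpow hβ.ne']
  have hR' : R < |u|⁻¹ := by
    rw [lt_inv_comm₀ hR h0]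
    linarith [inv_pos.2 hR]
  have hsub : Ioc |u|⁻¹ (2 * |u|⁻¹) ⊆ Ioi R := fun s hs => hR'.trans hs.1
  have hi : 0 < |u|⁻¹ := inv_pos.2 h0
  calc ENNReal.ofReal (4 / 9 * 2 ^ (-1 - β) * |u| ^ β)
      = ∫⁻ _ in Ioc |u|⁻¹ (2 * |u|⁻¹), ENNReal.ofReal (4 / 9 * (2 * |u|⁻¹) ^ (-1 - β)) := by
        rw [setLIntegral_const, Real.volume_Ioc, ← ENNReal.ofReal_mul (by positivity)]
        congr 1
        rw [Real.mul_rpow (by norm_num) hi.le, Real.inv_rpow h0.le, ← Real.rpow_neg h0.le,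
          show -(-1 - β) = β + 1 by ring, Real.rpow_add_one h0.ne']
        field_simp
        ring
    _ ≤ ∫⁻ s in Ioc |u|⁻¹ (2 * |u|⁻¹), ENNReal.ofReal ((1 - Real.cos (s * u)) * s ^ (-1 - β)) := by
        refine setLIntegral_mono' measurableSet_Ioc fun s hs => ENNReal.ofReal_le_ofReal ?_
        have hs0 : 0 < s := hi.trans hs.1
        have h1 : 1 ≤ s * |u| := by
          have := mul_le_mul_of_nonneg_right hs.1.le h0.le
          rwa [inv_mul_cancel₀ h0.ne'] at this
        have h2 : s * |u| ≤ 2 := by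
          have := mul_le_mul_of_nonneg_right hs.2 h0.le
          rwa [mul_assoc, inv_mul_cancel₀ h0.ne', mul_one] at this
        have hcos : Real.cos (s * u) ≤ 5 / 9 := by
          rw [← Real.cos_abs, abs_mul, abs_of_pos hs0]
          refine le_trans ?_ Real.cos_one_le
          exact Real.cos_le_cos_of_nonneg_of_le_pi zero_le_one
            (h2.trans (by linarith [Real.pi_gt_three])) h1
        refine mul_le_mul (by linarith) ?_ (by positivity) (by linarith)
        exact Real.rpow_le_rpow_of_nonpos hs0 hs.2 (by linarith)
    _ ≤ cosWeight β R u := lintegral_mono_set hsub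

end Weights

/-! ### Small jumps along a direction -/

section SmallJumps

open Set

variable {E : Type*} [NormedAddCommGroup E] [InnerProductSpace ℝ E] [FiniteDimensional ℝ E]
  [MeasurableSpace E] [BorelSpace E] {ν : Measure E} {γ : E} {p : ℝ → Measure E}

lemma integrable_one_sub_cos_inner {m : Measure E}
    (hm : Integrable (fun y : E => min 1 (‖y‖ ^ (2 : ℝ))) m) (ξ : E) :
    Integrable (fun y => 1 - Real.cos ⟪ξ, y⟫) m :=
  (hm.const_mul (2 * (1 + ‖ξ‖ ^ 2))).mono' (by fun_prop) (Eventually.of_forall fun y => by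
    rw [Real.norm_of_nonneg (by linarith [Real.cos_le_one ⟪ξ, y⟫])]
    exact one_sub_cos_inner_le ξ y)

lemma integral_one_sub_cos_inner_eq {m : Measure E} [IsProbabilityMeasure m] {ξ : E} {z : ℂ}
    (hz : ∫ x, Complex.exp (Complex.I * (⟪ξ, x⟫ : ℂ)) ∂m = z) :
    ∫ x, (1 - Real.cos ⟪ξ, x⟫) ∂m = 1 - z.re := by
  have hi : Integrable (fun x => Complex.exp (Complex.I * (⟪ξ, x⟫ : ℂ))) m :=
    Integrable.of_bound (by fun_prop) 1
      (Eventually.of_forall fun y => (Complex.norm_exp_I_mul_ofReal _).le)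
  have hc : Integrable (fun x => Real.cos ⟪ξ, x⟫) m :=
    Integrable.of_bound (by fun_prop) 1 (Eventually.of_forall fun ξ => Real.abs_cos_le_one _)
  have h : (∫ x, Complex.exp (Complex.I * (⟪ξ, x⟫ : ℂ)) ∂m).re = ∫ x, Real.cos ⟪ξ, x⟫ ∂m := by
    refine (integral_re hi).symm.trans ?_
    refine integral_congr_ae (Eventually.of_forall fun y => ?_)
    simp [Complex.exp_re]
  rw [integral_sub (integrable_const 1) hc, ← h, hz]
  simp

omit [FiniteDimensional ℝ E] in
lemma measurable_cosWeight_inner [SecondCountableTopology E] (β R : ℝ) (e : E) :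
    Measurable fun y => cosWeight β R ⟪e, y⟫ := by
  unfold cosWeight
  refine Measurable.lintegral_prod_right'
    (f := fun z : E × ℝ => ENNReal.ofReal ((1 - Real.cos (z.2 * ⟪e, z.1⟫)) * z.2 ^ (-1 - β))) ?_
  fun_prop

lemma lintegral_cosWeight_inner {m : Measure E} [SFinite m]
    (hm : Integrable (fun y : E => min 1 (‖y‖ ^ (2 : ℝ))) m) (β : ℝ) {R : ℝ} (hR : 0 ≤ R) (e : E) :
    ∫⁻ y, cosWeight β R ⟪e, y⟫ ∂m
      = ∫⁻ s in Ioi R, ENNReal.ofReal ((∫ y, (1 - Real.cos ⟪s • e, y⟫) ∂m) * s ^ (-1 - β)) := by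
  unfold cosWeight
  rw [lintegral_lintegral_swap]
  · refine setLIntegral_congr_fun measurableSet_Ioi fun s hs => ?_
    have hs0 : 0 < s := hR.trans_lt hs
    rw [← integral_mul_const, ofReal_integral_eq_lintegral_ofReal]
    · simp only [real_inner_smul_left]
    · exact (integrable_one_sub_cos_inner hm _).mul_const _
    · refine Eventually.of_forall fun y => ?_
      exact mul_nonneg (by linarith [Real.cos_le_one ⟪s • e, y⟫]) (by positivity)
  · refine Measurable.aemeasurable ?_
    unfold Function.uncurry
    fun_prop

omit [FiniteDimensional ℝ E] in
lemma tendsto_lintegral_cosWeight_inner [SecondCountableTopology E] {β : ℝ} (hβ0 : 0 < β)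
    (hβ2 : β < 2) (hν : Integrable (fun y : E => min 1 (‖y‖ ^ β)) ν) {e : E} (he : ‖e‖ = 1) :
    Tendsto (fun R => ∫⁻ y, cosWeight β R ⟪e, y⟫ ∂ν) atTop (𝓝 0) := by
  have hβ2' : 0 < 2 - β := sub_pos.2 hβ2
  have h := tendsto_lintegral_filter_of_dominated_convergence (μ := ν) (l := atTop)
    (F := fun R y => cosWeight β R ⟪e, y⟫) (f := fun _ => 0)
    (fun y => ENNReal.ofReal ((1 / (2 - β) + 2 / β) * min 1 (‖y‖ ^ β)))
    (Eventually.of_forall fun R => measurable_cosWeight_inner β R e) ?_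
    (hν.const_mul _).lintegral_lt_top.ne ?_
  · simpa using h
  · filter_upwards [eventually_ge_atTop 1] with R hR
    refine Eventually.of_forall fun y => ?_
    rw [mul_min_of_nonneg _ _ (by positivity), ENNReal.ofReal_min]
    refine le_min ?_ ?_
    · refine (cosWeight_le_rpow_neg hβ0 (by linarith) _).trans (ENNReal.ofReal_le_ofReal ?_)
      have h1 : R ^ (-β) ≤ 1 := Real.rpow_le_one_of_one_le_of_nonpos hR (by linarith)
      have h2 : 0 ≤ 1 / (2 - β) := by positivity
      have h3 : 2 / β * R ^ (-β) ≤ 2 / β * 1 := by gcongr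
      linarith
    · refine (cosWeight_le_abs_rpow hβ0 hβ2 (by linarith) _).trans (ENNReal.ofReal_le_ofReal ?_)
      gcongr
      simpa [he] using abs_real_inner_le_norm e y
  · refine Eventually.of_forall fun y => ?_
    have h0 : Tendsto (fun R : ℝ => ENNReal.ofReal (2 / β * R ^ (-β))) atTop (𝓝 0) := by
      have := ENNReal.tendsto_ofReal ((tendsto_rpow_neg_atTop hβ0).const_mul (2 / β))
      simpa using this
    refine tendsto_of_tendsto_of_tendsto_of_le_of_le' tendsto_const_nhds h0
      (Eventually.of_forall fun _ => zero_le) ?_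
    filter_upwards [eventually_gt_atTop 0] with R hR using cosWeight_le_rpow_neg hβ0 hR _

lemma lintegral_cosWeight_inner_le {m : Measure E} [IsProbabilityMeasure m] [SFinite ν]
    (hν : Integrable (fun y : E => min 1 (‖y‖ ^ (2 : ℝ))) ν) {t : ℝ} (ht : 0 < t)
    (hm : ∀ ξ, ∫ x, Complex.exp (Complex.I * (⟪ξ, x⟫ : ℂ)) ∂m
      = Complex.exp (-(t : ℂ) * levyExponent γ ν ξ))
    {β : ℝ} (hβ : 0 < β) {R : ℝ} (hR : 0 < R) {h : ℝ} (hh : 0 ≤ h) {e : E}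
    (hgrowth : ∀ s, R ≤ s → s ^ (-β) * ‖levyExponent γ ν (s • e)‖ ≤ h) :
    ∫⁻ x, cosWeight β R ⟪e, x⟫ ∂m
      ≤ ENNReal.ofReal t * (∫⁻ y, cosWeight β R ⟪e, y⟫ ∂ν + ENNReal.ofReal (3 / β * h)) := by
  set b : ℝ := (t * h) ^ (1 / β) with hb
  have hb0 : 0 ≤ b := by positivity
  have hbβ : b ^ β = t * h := by
    rw [hb, ← Real.rpow_mul (by positivity), one_div_mul_cancel hβ.ne', Real.rpow_one]
  have hstep : ∀ s ∈ Ioi R,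
      ENNReal.ofReal ((∫ x, (1 - Real.cos ⟪s • e, x⟫) ∂m) * s ^ (-1 - β))
        ≤ ENNReal.ofReal t
            * ENNReal.ofReal ((∫ y, (1 - Real.cos ⟪s • e, y⟫) ∂ν) * s ^ (-1 - β))
          + ENNReal.ofReal (min 2 ((b * s) ^ (2 * β)) * s ^ (-1 - β)) := by
    intro s hs
    have hs0 : 0 < s := hR.trans hs
    have hre := levyExponent_re_nonneg hν γ (s • e)
    rw [← levyExponent_re hν γ, integral_one_sub_cos_inner_eq (hm _), ← ENNReal.ofReal_mul ht.le,
      ← ENNReal.ofReal_add (by positivity) (by positivity)]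
    refine ENNReal.ofReal_le_ofReal ?_
    rw [← mul_assoc, ← add_mul]
    gcongr
    have hz := one_sub_re_exp_neg_le (z := (t : ℂ) * levyExponent γ ν (s • e))
      (by simpa using mul_nonneg ht.le hre)
    rw [← neg_mul] at hz
    refine hz.trans (add_le_add (by simp) (min_le_min_left _ ?_))
    have h1 : ‖levyExponent γ ν (s • e)‖ ≤ h * s ^ β := by
      have := hgrowth s (le_of_lt hs)
      rwa [Real.rpow_neg hs0.le, inv_mul_le_iff₀ (by positivity), mul_comm] at this
    have h2 : |((t : ℂ) * levyExponent γ ν (s • e)).im| ≤ (b * s) ^ β := by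
      rw [Complex.im_ofReal_mul, abs_mul, abs_of_pos ht, Real.mul_rpow hb0 hs0.le, hbβ, mul_assoc]
      gcongr
      exact (Complex.abs_im_le_norm _).trans h1
    rw [mul_comm 2 β, Real.rpow_mul (by positivity), Real.rpow_two, ← sq_abs]
    gcongr
  rw [lintegral_cosWeight_inner (integrable_min_one_rpow_of_isFiniteMeasure m zero_le_two) β hR.le,
    lintegral_cosWeight_inner hν β hR.le]
  refine (setLIntegral_mono' measurableSet_Ioi hstep).trans ?_
  rw [lintegral_add_right _ (by fun_prop), lintegral_const_mul' _ _ ENNReal.ofReal_ne_top, mul_add]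
  gcongr
  refine (lintegral_mono_set (Ioi_subset_Ioi hR.le)).trans ?_
  refine (lintegral_min_two_rpow_le hβ (by linarith) hb0).trans ?_
  rw [hbβ, ← ENNReal.ofReal_mul ht.le]
  refine ENNReal.ofReal_le_ofReal (le_of_eq ?_)
  rw [show 2 * β - β = β by ring]
  ring

lemma exists_setLIntegral_abs_inner_rpow_le_of_lt_two (hν0 : ν {0} = 0)
    (hν2 : Integrable (fun y : E => min 1 (‖y‖ ^ (2 : ℝ))) ν)
    (hp : ∀ t, 0 < t → IsProbabilityMeasure (p t))
    (hchar : ∀ t, 0 < t → ∀ ξ, ∫ x, Complex.exp (Complex.I * (⟪ξ, x⟫ : ℂ)) ∂(p t)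
      = Complex.exp (-(t : ℂ) * levyExponent γ ν ξ))
    {β : ℝ} (hβ0 : 0 < β) (hβ2 : β < 2) (hν : Integrable (fun y : E => min 1 (‖y‖ ^ β)) ν)
    {e : E} (he : ‖e‖ = 1)
    (hgrowth : Tendsto (fun s : ℝ => s ^ (-β) * ‖levyExponent γ ν (s • e)‖) atTop (𝓝 0))
    {δ : ℝ} (hδ : 0 < δ) :
    ∃ ε > 0, ∀ t, 0 < t →
      ∫⁻ x in {x | |⟪e, x⟫| ≤ ε}, ENNReal.ofReal (|⟪e, x⟫| ^ β) ∂(p t) ≤ ENNReal.ofReal (δ * t) := by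
  have := sigmaFinite_of_integrable_min_one_rpow hν0 hν2
  set c : ℝ := 4 / 9 * 2 ^ (-1 - β) with hc
  have hc0 : 0 < c := by positivity
  set h : ℝ := β / 3 * (c * δ / 2) with hh
  have hh0 : 0 < h := by positivity
  have hA : ∀ᶠ R in atTop, ∫⁻ y, cosWeight β R ⟪e, y⟫ ∂ν ≤ ENNReal.ofReal (c * δ / 2) :=
    (tendsto_lintegral_cosWeight_inner hβ0 hβ2 hν he).eventually_le_const
      (ENNReal.ofReal_pos.2 (by positivity))
  obtain ⟨R₀, hR₀⟩ := eventually_atTop.1 (hgrowth.eventually_le_const hh0)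
  obtain ⟨R, hRA, hRR, hR⟩ :=
    (hA.and ((eventually_ge_atTop R₀).and (eventually_gt_atTop 0))).exists
  refine ⟨R⁻¹ / 2, by positivity, fun t ht => ?_⟩
  have := hp t ht
  have hm : MeasurableSet {x : E | |⟪e, x⟫| ≤ R⁻¹ / 2} :=
    measurableSet_le (by fun_prop) measurable_const
  have hmain := lintegral_cosWeight_inner_le hν2 ht (hchar t ht) hβ0 hR hh0.le
    (fun s hs => hR₀ s (hRR.trans hs))
  have hsum : ENNReal.ofReal t * (∫⁻ y, cosWeight β R ⟪e, y⟫ ∂ν + ENNReal.ofReal (3 / β * h))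
      ≤ ENNReal.ofReal c * ENNReal.ofReal (δ * t) := by
    rw [← ENNReal.ofReal_mul hc0.le]
    calc _ ≤ ENNReal.ofReal t * (ENNReal.ofReal (c * δ / 2) + ENNReal.ofReal (3 / β * h)) := by
          gcongr
      _ = ENNReal.ofReal (c * (δ * t)) := by
          rw [← ENNReal.ofReal_add (by positivity) (by positivity), ← ENNReal.ofReal_mul ht.le, hh]
          congr 1
          field_simp
          ring
  have hle : ENNReal.ofReal c
      * ∫⁻ x in {x | |⟪e, x⟫| ≤ R⁻¹ / 2}, ENNReal.ofReal (|⟪e, x⟫| ^ β) ∂(p t)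
      ≤ ENNReal.ofReal c * ENNReal.ofReal (δ * t) := by
    refine le_trans ?_ (hmain.trans hsum)
    rw [← lintegral_const_mul' _ _ ENNReal.ofReal_ne_top]
    refine (setLIntegral_mono' hm fun x hx => ?_).trans (setLIntegral_le_lintegral _ _)
    rw [← ENNReal.ofReal_mul hc0.le]
    exact abs_rpow_le_cosWeight hβ0 hR hx
  exact (ENNReal.mul_le_mul_iff_right (ENNReal.ofReal_pos.2 hc0).ne' ENNReal.ofReal_ne_top).1 hle

lemma exists_setLIntegral_abs_inner_sq_le
    (hν : Integrable (fun y : E => min 1 (‖y‖ ^ (2 : ℝ))) ν)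
    (hp : ∀ t, 0 < t → IsProbabilityMeasure (p t))
    (hchar : ∀ t, 0 < t → ∀ ξ, ∫ x, Complex.exp (Complex.I * (⟪ξ, x⟫ : ℂ)) ∂(p t)
      = Complex.exp (-(t : ℂ) * levyExponent γ ν ξ)) {e : E}
    (hgrowth : Tendsto (fun s : ℝ => s ^ (-(2 : ℝ)) * ‖levyExponent γ ν (s • e)‖) atTop (𝓝 0))
    {δ : ℝ} (hδ : 0 < δ) :
    ∃ ε > 0, ∀ t, 0 < t → ∫⁻ x in {x | |⟪e, x⟫| ≤ ε}, ENNReal.ofReal (|⟪e, x⟫| ^ (2 : ℝ)) ∂(p t)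
      ≤ ENNReal.ofReal (δ * t) := by
  have hh0 : 0 < δ / (Real.pi ^ 2 / 2) := by positivity
  obtain ⟨R, hR, hR0⟩ :=
    ((hgrowth.eventually_le_const hh0).and (eventually_gt_atTop 0)).exists
  refine ⟨R⁻¹, by positivity, fun t ht => ?_⟩
  have := hp t ht
  have hi := integrable_one_sub_cos_inner
    (integrable_min_one_rpow_of_isFiniteMeasure (p t) zero_le_two) (R • e)
  have hm : MeasurableSet {x : E | |⟪e, x⟫| ≤ R⁻¹} :=
    measurableSet_le (by fun_prop) measurable_const
  calc ∫⁻ x in {x | |⟪e, x⟫| ≤ R⁻¹}, ENNReal.ofReal (|⟪e, x⟫| ^ (2 : ℝ)) ∂(p t)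
      ≤ ∫⁻ x in {x | |⟪e, x⟫| ≤ R⁻¹},
          ENNReal.ofReal (Real.pi ^ 2 / 2 * R ^ (-(2 : ℝ)) * (1 - Real.cos ⟪R • e, x⟫)) ∂(p t) := by
        refine setLIntegral_mono' hm fun x hx => ENNReal.ofReal_le_ofReal ?_
        have hx1 : |R * ⟪e, x⟫| ≤ Real.pi := by
          have h1 : R * |⟪e, x⟫| ≤ R * R⁻¹ := mul_le_mul_of_nonneg_left hx hR0.le
          rw [mul_inv_cancel₀ hR0.ne'] at h1
          rw [abs_mul, abs_of_pos hR0]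
          linarith [Real.pi_gt_three]
        have h2 := Real.cos_le_one_sub_mul_cos_sq hx1
        rw [real_inner_smul_left, Real.rpow_two, Real.rpow_neg hR0.le, Real.rpow_two, sq_abs]
        calc ⟪e, x⟫ ^ 2 = Real.pi ^ 2 / 2 * (R ^ 2)⁻¹ * (2 / Real.pi ^ 2 * (R * ⟪e, x⟫) ^ 2) := by
              field_simp [Real.pi_ne_zero]
          _ ≤ _ := by
              gcongr
              linarith
    _ ≤ ∫⁻ x, ENNReal.ofReal
          (Real.pi ^ 2 / 2 * R ^ (-(2 : ℝ)) * (1 - Real.cos ⟪R • e, x⟫)) ∂(p t) :=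
        setLIntegral_le_lintegral _ _
    _ = ENNReal.ofReal (Real.pi ^ 2 / 2 * R ^ (-(2 : ℝ))
          * (1 - (Complex.exp (-(t : ℂ) * levyExponent γ ν (R • e))).re)) := by
        rw [← ofReal_integral_eq_lintegral_ofReal (hi.const_mul _), integral_const_mul,
          integral_one_sub_cos_inner_eq (hchar t ht _)]
        refine Eventually.of_forall fun x => ?_
        exact mul_nonneg (by positivity) (by linarith [Real.cos_le_one ⟪R • e, x⟫])
    _ ≤ ENNReal.ofReal (δ * t) := by
        refine ENNReal.ofReal_le_ofReal ?_
        have h1 := norm_one_sub_exp_neg_le (z := (t : ℂ) * levyExponent γ ν (R • e))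
          (by simpa using mul_nonneg ht.le (levyExponent_re_nonneg hν γ (R • e)))
        have h2 := (Complex.re_le_norm _).trans h1
        rw [norm_mul, Complex.norm_real, Real.norm_of_nonneg ht.le, ← neg_mul, Complex.sub_re,
          Complex.one_re] at h2
        calc _ ≤ Real.pi ^ 2 / 2 * R ^ (-(2 : ℝ)) * (t * ‖levyExponent γ ν (R • e)‖) := by gcongr
          _ = Real.pi ^ 2 / 2 * (R ^ (-(2 : ℝ)) * ‖levyExponent γ ν (R • e)‖) * t := by ring
          _ ≤ Real.pi ^ 2 / 2 * (δ / (Real.pi ^ 2 / 2)) * t := by gcongr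
          _ = δ * t := by field_simp

lemma exists_setLIntegral_abs_inner_rpow_le (hν0 : ν {0} = 0)
    (hp : ∀ t, 0 < t → IsProbabilityMeasure (p t))
    (hchar : ∀ t, 0 < t → ∀ ξ, ∫ x, Complex.exp (Complex.I * (⟪ξ, x⟫ : ℂ)) ∂(p t)
      = Complex.exp (-(t : ℂ) * levyExponent γ ν ξ))
    {β : ℝ} (hβ0 : 0 < β) (hβ2 : β ≤ 2) (hν : Integrable (fun y : E => min 1 (‖y‖ ^ β)) ν)
    (hγ : β ≤ 1 → γ = ∫ y in {y : E | ‖y‖ ≤ 1}, y ∂ν) {e : E} (he : ‖e‖ = 1)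
    {δ : ℝ} (hδ : 0 < δ) :
    ∃ ε > 0, ∀ t, 0 < t →
      ∫⁻ x in {x | |⟪e, x⟫| ≤ ε}, ENNReal.ofReal (|⟪e, x⟫| ^ β) ∂(p t) ≤ ENNReal.ofReal (δ * t) := by
  have hgrowth := tendsto_rpow_neg_mul_norm_levyExponent hβ0 hβ2 hν hγ he
  rcases hβ2.lt_or_eq with hβ2 | rfl
  · exact exists_setLIntegral_abs_inner_rpow_le_of_lt_two hν0
      (integrable_min_one_rpow_mono hβ0.le hβ2.le two_pos hν) hp hchar hβ0 hβ2 hν he hgrowth hδ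
  · exact exists_setLIntegral_abs_inner_sq_le hν hp hchar hgrowth hδ

omit [FiniteDimensional ℝ E] [MeasurableSpace E] [BorelSpace E] in
lemma norm_rpow_le_sum_abs_inner_rpow {ι : Type*} [Fintype ι] (b : OrthonormalBasis ι ℝ E) {β : ℝ}
    (hβ : 0 < β) (x : E) :
    ‖x‖ ^ β ≤ (Fintype.card ι : ℝ) ^ β * ∑ i, |⟪b i, x⟫| ^ β := by
  have hsum : ‖x‖ ≤ ∑ i, |⟪b i, x⟫| := by
    conv_lhs => rw [← b.sum_repr' x]
    refine (norm_sum_le _ _).trans (le_of_eq ?_)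
    simp [norm_smul]
  rcases isEmpty_or_nonempty ι with hι | hι
  · have hx : ‖x‖ = 0 := le_antisymm (by simpa using hsum) (norm_nonneg x)
    simp [hx, Real.zero_rpow hβ.ne']
  have hn : (0 : ℝ) < Fintype.card ι := by exact_mod_cast Fintype.card_pos
  obtain ⟨i, -, hi⟩ := Finset.exists_le_of_sum_le (s := Finset.univ)
    (f := fun _ : ι => ‖x‖ / Fintype.card ι) (g := fun i => |⟪b i, x⟫|) Finset.univ_nonempty (by
      simpa [mul_div_cancel₀ _ hn.ne'] using hsum)
  rw [div_le_iff₀' hn] at hi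
  calc ‖x‖ ^ β ≤ (Fintype.card ι * |⟪b i, x⟫|) ^ β := by gcongr
    _ = (Fintype.card ι : ℝ) ^ β * |⟪b i, x⟫| ^ β := Real.mul_rpow hn.le (abs_nonneg _)
    _ ≤ _ := by
        gcongr
        exact Finset.single_le_sum (f := fun i => |⟪b i, x⟫| ^ β) (fun j _ => by positivity)
          (Finset.mem_univ i)

lemma measure_ne_zero_le {m : Measure E} [IsProbabilityMeasure m] {B : ℝ}
    (hm : ∀ ξ, ‖1 - charFun m ξ‖ ≤ B) :
    m {x | x ≠ 0} ≤ ENNReal.ofReal (Module.finrank ℝ E * (2 * B)) := by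
  have hdir : ∀ e : E, m {x | ⟪e, x⟫ ≠ 0} ≤ ENNReal.ofReal (2 * B) := by
    intro e
    have hset : {x : E | ⟪e, x⟫ ≠ 0} = ⋃ n : ℕ, {x | 1 / ((n : ℝ) + 1) < |⟪e, x⟫|} := by
      ext x
      simp only [mem_ofPred_eq, mem_iUnion]
      refine ⟨fun h => exists_nat_one_div_lt (abs_pos.2 h), fun ⟨n, hn⟩ => ?_⟩
      exact abs_pos.1 (lt_trans (by positivity) hn)
    have hmono : Monotone fun n : ℕ => {x : E | 1 / ((n : ℝ) + 1) < |⟪e, x⟫|} := by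
      intro i j hij x hx
      exact lt_of_le_of_lt (Nat.one_div_le_one_div (α := ℝ) hij) (mem_ofPred_eq.mp hx)
    rw [hset, hmono.measure_iUnion]
    refine iSup_le fun n => ?_
    have hr : (0 : ℝ) < 1 / ((n : ℝ) + 1) := by positivity
    rw [← ofReal_measureReal]
    refine ENNReal.ofReal_le_ofReal ((measureReal_abs_inner_gt_le_integral_charFun hr).trans ?_)
    have h := intervalIntegral.norm_integral_le_of_norm_le_const (C := B)
      (a := -2 * (1 / ((n : ℝ) + 1))⁻¹) (b := 2 * (1 / ((n : ℝ) + 1))⁻¹)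
      (f := fun t : ℝ => 1 - charFun m (t • e)) (fun t _ => hm _)
    rw [show 2 * (1 / ((n : ℝ) + 1))⁻¹ - -2 * (1 / ((n : ℝ) + 1))⁻¹
      = 4 * (1 / ((n : ℝ) + 1))⁻¹ by ring, abs_of_pos (by positivity)] at h
    calc _ ≤ 2⁻¹ * (1 / ((n : ℝ) + 1)) * (B * (4 * (1 / ((n : ℝ) + 1))⁻¹)) := by gcongr
      _ = 2 * B := by
          field_simp
          ring
  set b := stdOrthonormalBasis ℝ E
  have hsub : {x : E | x ≠ 0} ⊆ ⋃ i, {x | ⟪b i, x⟫ ≠ 0} := by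
    intro x hx
    by_contra hcon
    simp only [mem_iUnion, mem_ofPred_eq, not_exists, not_not] at hcon
    refine hx ?_
    rw [← b.sum_repr' x]
    simp [hcon]
  calc m {x | x ≠ 0} ≤ ∑ i, m {x | ⟪b i, x⟫ ≠ 0} :=
        (measure_mono hsub).trans (measure_iUnion_fintype_le _ _)
    _ ≤ ∑ _i : Fin (Module.finrank ℝ E), ENNReal.ofReal (2 * B) :=
        Finset.sum_le_sum fun i _ => hdir _
    _ = ENNReal.ofReal (Module.finrank ℝ E * (2 * B)) := by
        rw [Finset.sum_const, Finset.card_univ, Fintype.card_fin, nsmul_eq_mul,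
          ENNReal.ofReal_mul (Nat.cast_nonneg _), ENNReal.ofReal_natCast]

lemma exists_setLIntegral_norm_lt_le_of_zero
    (hp : ∀ t, 0 < t → IsProbabilityMeasure (p t))
    (hchar : ∀ t, 0 < t → ∀ ξ, ∫ x, Complex.exp (Complex.I * (⟪ξ, x⟫ : ℂ)) ∂(p t)
      = Complex.exp (-(t : ℂ) * levyExponent γ ν ξ))
    (hν : Integrable (fun y : E => min 1 (‖y‖ ^ (0 : ℝ))) ν)
    (hν2 : Integrable (fun y : E => min 1 (‖y‖ ^ (2 : ℝ))) ν)
    (hγ : γ = ∫ y in {y : E | ‖y‖ ≤ 1}, y ∂ν)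
    {f : E → ℝ} (hfc : Continuous f) (hf0 : f 0 = 0) {δ : ℝ} (hδ : 0 < δ) :
    ∃ ε > 0, ∀ t, 0 < t →
      ∫⁻ x in {x | ‖x‖ < ε}, ENNReal.ofReal |f x| ∂(p t) ≤ ENNReal.ofReal (δ * t) := by
  obtain ⟨B, hB0, hB⟩ : ∃ B, 0 ≤ B ∧ ∀ ξ, ‖levyExponent γ ν ξ‖ ≤ B := by
    refine ⟨4 * ∫ y, min 1 (‖y‖ ^ (0 : ℝ)) ∂ν, by positivity, fun ξ => ?_⟩
    rw [levyExponent_of_drift_eq_zero le_rfl zero_le_one hν hγ, norm_neg, ← integral_const_mul]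
    refine norm_integral_le_of_norm_le (hν.const_mul _) (Eventually.of_forall fun y => ?_)
    refine (norm_exp_I_mul_inner_sub_one_le le_rfl zero_le_one ξ y).trans (le_of_eq ?_)
    rw [Real.rpow_zero]
    norm_num
  set K : ℝ := Module.finrank ℝ E * (2 * B) with hK
  have hK0 : 0 ≤ K := by positivity
  have hη : 0 < δ / (K + 1) := by positivity
  obtain ⟨ε, hε, hfε⟩ := Metric.continuousAt_iff.1 (hfc.continuousAt (x := 0)) _ hη
  refine ⟨ε, hε, fun t ht => ?_⟩
  have := hp t ht
  have hm0 : MeasurableSet {x : E | x ≠ 0} := (measurableSet_singleton 0).compl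
  have hmass : p t {x | x ≠ 0} ≤ ENNReal.ofReal (K * t) := by
    refine (measure_ne_zero_le (B := t * B) fun ξ => ?_).trans (le_of_eq ?_)
    · have hcf : charFun (p t) ξ = Complex.exp (-((t : ℂ) * levyExponent γ ν ξ)) := by
        rw [← neg_mul, ← hchar t ht, charFun_apply]
        refine integral_congr_ae (Eventually.of_forall fun x => ?_)
        simp only
        rw [real_inner_comm, mul_comm]
      rw [hcf]
      refine (norm_one_sub_exp_neg_le ?_).trans ?_
      · simpa using mul_nonneg ht.le (levyExponent_re_nonneg hν2 γ ξ)
      · rw [norm_mul, Complex.norm_real, Real.norm_of_nonneg ht.le]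
        gcongr
        exact hB ξ
    · rw [hK]
      congr 1
      ring
  calc ∫⁻ x in {x | ‖x‖ < ε}, ENNReal.ofReal |f x| ∂(p t)
      ≤ ∫⁻ x in {x | ‖x‖ < ε}, {x : E | x ≠ 0}.indicator
          (fun _ => ENNReal.ofReal (δ / (K + 1))) x ∂(p t) := by
        refine setLIntegral_mono' (measurableSet_lt measurable_norm measurable_const) fun x hx => ?_
        by_cases hx0 : x = 0
        · simp [hx0, hf0]
        · rw [indicator_of_mem (by exact hx0)]
          have := hfε (x := x) (by simpa using hx)
          rw [hf0, dist_zero_right] at this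
          exact ENNReal.ofReal_le_ofReal this.le
    _ ≤ ∫⁻ x, {x : E | x ≠ 0}.indicator (fun _ => ENNReal.ofReal (δ / (K + 1))) x ∂(p t) :=
        setLIntegral_le_lintegral _ _
    _ = ENNReal.ofReal (δ / (K + 1)) * p t {x | x ≠ 0} := lintegral_indicator_const hm0 _
    _ ≤ ENNReal.ofReal (δ / (K + 1)) * ENNReal.ofReal (K * t) := by gcongr
    _ ≤ ENNReal.ofReal (δ * t) := by
        rw [← ENNReal.ofReal_mul hη.le]
        refine ENNReal.ofReal_le_ofReal ?_
        calc δ / (K + 1) * (K * t) = δ * t * (K / (K + 1)) := by ring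
          _ ≤ δ * t * 1 := by
              gcongr
              rw [div_le_one (by positivity)]
              linarith
          _ = δ * t := mul_one _

lemma exists_setLIntegral_norm_lt_le (hν0 : ν {0} = 0)
    (hp : ∀ t, 0 < t → IsProbabilityMeasure (p t))
    (hchar : ∀ t, 0 < t → ∀ ξ, ∫ x, Complex.exp (Complex.I * (⟪ξ, x⟫ : ℂ)) ∂(p t)
      = Complex.exp (-(t : ℂ) * levyExponent γ ν ξ))
    {β : ℝ} (hβ0 : 0 ≤ β) (hβ2 : β ≤ 2) (hν : Integrable (fun y : E => min 1 (‖y‖ ^ β)) ν)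
    (hγ : β ≤ 1 → γ = ∫ y in {y : E | ‖y‖ ≤ 1}, y ∂ν)
    {f : E → ℝ} (hfc : Continuous f) (hf0 : f 0 = 0) {C : ℝ} (hC : 0 ≤ C)
    (hfH : ∀ x, ‖x‖ < 1 → |f x| ≤ C * ‖x‖ ^ β) {δ : ℝ} (hδ : 0 < δ) :
    ∃ ε > 0, ∀ t, 0 < t →
      ∫⁻ x in {x | ‖x‖ < ε}, ENNReal.ofReal |f x| ∂(p t) ≤ ENNReal.ofReal (δ * t) := by
  rcases hβ0.eq_or_lt with rfl | hβ0
  · exact exists_setLIntegral_norm_lt_le_of_zero hp hchar hν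
      (integrable_min_one_rpow_mono le_rfl zero_le_two two_pos hν) (hγ zero_le_one) hfc hf0 hδ
  set b := stdOrthonormalBasis ℝ E
  set n : ℝ := (Fintype.card (Fin (Module.finrank ℝ E)) : ℝ) with hn
  have hn0 : 0 ≤ n := by positivity
  set K : ℝ := n * (C * n ^ β) with hK
  have hK0 : 0 ≤ K := by positivity
  have hη : 0 < δ / (K + 1) := by positivity
  choose r hr hle using fun i => exists_setLIntegral_abs_inner_rpow_le hν0 hp hchar hβ0 hβ2 hν hγ
    (b.norm_eq_one i) hη
  have hev : ∀ᶠ ε in 𝓝[>] (0 : ℝ), (∀ i, ε ≤ r i) ∧ ε ≤ 1 ∧ 0 < ε := by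
    refine (eventually_all.2 fun i => ?_).and (.and ?_ self_mem_nhdsWithin)
    · filter_upwards [Ioc_mem_nhdsGT (hr i)] with ε h using h.2
    · filter_upwards [Ioc_mem_nhdsGT (zero_lt_one' ℝ)] with ε h using h.2
  obtain ⟨ε, hεr, hε1, hε⟩ := hev.exists
  refine ⟨ε, hε, fun t ht => ?_⟩
  calc ∫⁻ x in {x | ‖x‖ < ε}, ENNReal.ofReal |f x| ∂(p t)
      ≤ ∫⁻ x in {x | ‖x‖ < ε},
          ∑ i, ENNReal.ofReal (C * n ^ β) * ENNReal.ofReal (|⟪b i, x⟫| ^ β) ∂(p t) := by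
        refine setLIntegral_mono' (measurableSet_lt measurable_norm measurable_const) fun x hx => ?_
        rw [← Finset.mul_sum, ← ENNReal.ofReal_sum_of_nonneg (fun i _ => by positivity),
          ← ENNReal.ofReal_mul (by positivity)]
        refine ENNReal.ofReal_le_ofReal ((hfH x (lt_of_lt_of_le hx hε1)).trans ?_)
        rw [mul_assoc]
        gcongr
        exact norm_rpow_le_sum_abs_inner_rpow b hβ0 x
    _ = ∑ i, ENNReal.ofReal (C * n ^ β)
          * ∫⁻ x in {x | ‖x‖ < ε}, ENNReal.ofReal (|⟪b i, x⟫| ^ β) ∂(p t) := by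
        rw [lintegral_finsetSum _ (fun i _ => by fun_prop)]
        simp only [lintegral_const_mul' _ _ ENNReal.ofReal_ne_top]
    _ ≤ ∑ _i : Fin (Module.finrank ℝ E),
          ENNReal.ofReal (C * n ^ β) * ENNReal.ofReal (δ / (K + 1) * t) := by
        gcongr with i
        refine (lintegral_mono_set fun x hx => ?_).trans (hle i t ht)
        have h1 : |⟪b i, x⟫| ≤ ‖x‖ := by simpa using abs_real_inner_le_norm (b i) x
        exact h1.trans ((le_of_lt hx).trans (hεr i))
    _ ≤ ENNReal.ofReal (δ * t) := by
        rw [Finset.sum_const, nsmul_eq_mul, Finset.card_univ, ← ENNReal.ofReal_natCast,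
          ← ENNReal.ofReal_mul (by positivity), ← ENNReal.ofReal_mul hn0]
        refine ENNReal.ofReal_le_ofReal ?_
        calc n * (C * n ^ β * (δ / (K + 1) * t)) = δ * t * (K / (K + 1)) := by
              rw [hK]
              ring
          _ ≤ δ * t * 1 := by
              gcongr
              rw [div_le_one (by positivity)]
              linarith
          _ = δ * t := mul_one _

end SmallJumps

/-! ### The small-time limit -/

section SmallTime

variable {E : Type*} [NormedAddCommGroup E] [InnerProductSpace ℝ E] [FiniteDimensional ℝ E]
  [MeasurableSpace E] [BorelSpace E] {ν : Measure E} {γ : E} {p : ℝ → Measure E}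

omit [InnerProductSpace ℝ E] [FiniteDimensional ℝ E] [BorelSpace E] in
lemma integrable_of_abs_le_rpow {β : ℝ} (hβ : 0 ≤ β)
    (hν : Integrable (fun y : E => min 1 (‖y‖ ^ β)) ν) {f : E → ℝ} (hfm : AEStronglyMeasurable f ν)
    {M C : ℝ} (hfM : ∀ x, |f x| ≤ M) (hfH : ∀ x, ‖x‖ < 1 → |f x| ≤ C * ‖x‖ ^ β) :
    Integrable f ν := by
  refine (hν.const_mul (max C M)).mono' hfm (Eventually.of_forall fun x => ?_)
  rw [Real.norm_eq_abs]
  rcases lt_or_ge ‖x‖ 1 with hx | hx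
  · rw [min_eq_right (Real.rpow_le_one (norm_nonneg x) hx.le hβ)]
    refine (hfH x hx).trans ?_
    gcongr
    exact le_max_left _ _
  · rw [min_eq_left (Real.one_le_rpow hx hβ), mul_one]
    exact (hfM x).trans (le_max_right _ _)

omit [InnerProductSpace ℝ E] [FiniteDimensional ℝ E] in
lemma tendsto_setLIntegral_norm_lt_zero {f : E → ℝ} (hf : Integrable f ν) (hfc : Continuous f)
    (hf0 : f 0 = 0) :
    Tendsto (fun ε : ℝ => ∫⁻ x in {x | ‖x‖ < ε}, ENNReal.ofReal |f x| ∂ν) (𝓝[>] 0) (𝓝 0) := by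
  have hm : ∀ ε : ℝ, MeasurableSet {x : E | ‖x‖ < ε} := fun ε =>
    measurableSet_lt measurable_norm measurable_const
  have h := tendsto_lintegral_filter_of_dominated_convergence (μ := ν) (l := 𝓝[>] (0 : ℝ))
    (F := fun ε => {x | ‖x‖ < ε}.indicator fun x => ENNReal.ofReal |f x|) (f := fun _ => 0)
    (fun x => ENNReal.ofReal |f x|)
    (Eventually.of_forall fun ε => Measurable.indicator (by fun_prop) (hm ε))
    (Eventually.of_forall fun ε => Eventually.of_forall fun x => Set.indicator_le_self _ _ _)
    hf.abs.lintegral_lt_top.ne ?_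
  · simpa only [lintegral_indicator (hm _), lintegral_zero] using h
  · refine Eventually.of_forall fun x => tendsto_const_nhds.congr' ?_
    by_cases hx : x = 0
    · simp [hx, hf0, Set.indicator]
    · filter_upwards [Ioc_mem_nhdsGT (norm_pos_iff.2 hx)] with ε hε
      rw [Set.indicator_of_notMem]
      simpa using hε.2

/-- A continuous cutoff vanishing on the ball of radius `ε / 2` and equal to one off the ball of
radius `ε`. -/
noncomputable def radialCutoff (ε : ℝ) (x : E) : ℝ := max 0 (min 1 (2 * ‖x‖ / ε - 1))

omit [InnerProductSpace ℝ E] [FiniteDimensional ℝ E] [BorelSpace E] in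
lemma abs_integral_mul_one_sub_radialCutoff_le {m : Measure E} {f : E → ℝ} {ε : ℝ} (hε : 0 < ε)
    {a : ℝ} (ha : 0 ≤ a) (hm : MeasurableSet {x : E | ‖x‖ < ε})
    (h : ∫⁻ x in {x | ‖x‖ < ε}, ENNReal.ofReal |f x| ∂m ≤ ENNReal.ofReal a) :
    |∫ x, f x * (1 - radialCutoff ε x) ∂m| ≤ a := by
  rw [← ENNReal.ofReal_le_ofReal_iff ha, ← Real.norm_eq_abs, ofReal_norm]
  refine (enorm_integral_le_lintegral_enorm _).trans (le_trans ?_ h)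
  rw [← lintegral_indicator hm]
  refine lintegral_mono fun x => ?_
  have h0 : 0 ≤ radialCutoff ε x := le_max_left _ _
  have h1 : radialCutoff ε x ≤ 1 := max_le zero_le_one (min_le_left _ _)
  by_cases hx : ‖x‖ < ε
  · rw [Set.indicator_of_mem (by exact hx), ← ofReal_norm, norm_mul, Real.norm_eq_abs,
      Real.norm_eq_abs]
    refine ENNReal.ofReal_le_ofReal (mul_le_of_le_one_right (abs_nonneg _) ?_)
    rw [abs_le]
    constructor <;> linarith
  · have h2 : 1 ≤ 2 * ‖x‖ / ε - 1 := by
      have : 2 ≤ 2 * ‖x‖ / ε := by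
        rw [le_div_iff₀ hε]
        linarith
      linarith
    have h3 : radialCutoff ε x = 1 := by
      rw [radialCutoff, min_eq_left h2, max_eq_right zero_le_one]
    simp [h3]

lemma tendsto_inv_mul_integral (hν0 : ν {0} = 0)
    (hp : ∀ t, 0 < t → IsProbabilityMeasure (p t))
    (hchar : ∀ t, 0 < t → ∀ ξ, ∫ x, Complex.exp (Complex.I * (⟪ξ, x⟫ : ℂ)) ∂(p t)
      = Complex.exp (-(t : ℂ) * levyExponent γ ν ξ))
    {β : ℝ} (hβ0 : 0 ≤ β) (hβ2 : β ≤ 2) (hν : Integrable (fun y : E => min 1 (‖y‖ ^ β)) ν)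
    (hγ : β ≤ 1 → γ = ∫ y in {y : E | ‖y‖ ≤ 1}, y ∂ν)
    {f : E → ℝ} (hfc : Continuous f) (hf0 : f 0 = 0) {M : ℝ} (hfM : ∀ x, |f x| ≤ M)
    {C : ℝ} (hC : 0 ≤ C) (hfH : ∀ x, ‖x‖ < 1 → |f x| ≤ C * ‖x‖ ^ β) :
    Tendsto (fun t : ℝ => t⁻¹ * ∫ x, f x ∂(p t)) (𝓝[>] 0) (𝓝 (∫ x, f x ∂ν)) := by
  have hf := integrable_of_abs_le_rpow hβ0 hν hfc.aestronglyMeasurable hfM hfH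
  rw [Metric.tendsto_nhds]
  intro η hη
  obtain ⟨ε₁, hε₁, hsmall⟩ := exists_setLIntegral_norm_lt_le hν0 hp hchar hβ0 hβ2 hν hγ hfc hf0 hC
    hfH (δ := η / 4) (by positivity)
  obtain ⟨ε, hνε, hεle, hε⟩ := (((tendsto_setLIntegral_norm_lt_zero hf hfc hf0).eventually_le_const
    (ENNReal.ofReal_pos.2 (show 0 < η / 4 by positivity))).and
    (.and (Ioc_mem_nhdsGT hε₁) self_mem_nhdsWithin)).exists
  replace hε : 0 < ε := hε
  have hmeas : MeasurableSet {x : E | ‖x‖ < ε} := measurableSet_lt measurable_norm measurable_const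
  have hχc : Continuous (radialCutoff ε : E → ℝ) := by
    unfold radialCutoff
    fun_prop
  have hχ1 : ∀ x : E, |radialCutoff ε x| ≤ 1 := fun x => by
    rw [abs_of_nonneg (le_max_left _ _)]
    exact max_le zero_le_one (min_le_left _ _)
  have hsplit : ∀ m : Measure E, Integrable f m → ∫ x, f x ∂m
      = ∫ x, f x * radialCutoff ε x ∂m + ∫ x, f x * (1 - radialCutoff ε x) ∂m := by
    intro m hfm
    have hG : Integrable (fun x => f x * radialCutoff ε x) m :=
      hfm.mul_bdd (c := 1) hχc.aestronglyMeasurable (Eventually.of_forall hχ1)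
    rw [← integral_add hG]
    · refine integral_congr_ae (Eventually.of_forall fun x => ?_)
      ring
    · refine (hfm.sub hG).congr (Eventually.of_forall fun x => ?_)
      simp [mul_sub]
  have hG := tendsto_inv_mul_integral_of_vanishing hν0
    (integrable_min_one_rpow_mono hβ0 hβ2 two_pos hν) hp hchar
    (G := fun x => f x * radialCutoff ε x) (hfc.mul hχc) (M := M)
    (fun x => by
      rw [abs_mul]
      exact (mul_le_of_le_one_right (abs_nonneg _) (hχ1 x)).trans (hfM x))
    (half_pos hε) (fun x hx => by
      have h1 : 2 * ‖x‖ / ε - 1 ≤ 0 := by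
        rw [sub_nonpos, div_le_one hε]
        linarith
      simp only [radialCutoff]
      rw [max_eq_left ((min_le_right _ _).trans h1), mul_zero])
  filter_upwards [Metric.tendsto_nhds.1 hG (η / 4) (by positivity), self_mem_nhdsWithin] with t hGt ht
  replace ht : 0 < t := ht
  have := hp t ht
  have hfp : Integrable f (p t) :=
    Integrable.of_bound hfc.aestronglyMeasurable M (Eventually.of_forall hfM)
  have h1 := abs_integral_mul_one_sub_radialCutoff_le hε (by positivity) hmeas hνε
  have h2 := abs_integral_mul_one_sub_radialCutoff_le hε (a := η / 4 * t) (by positivity) hmeas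
    ((lintegral_mono_set fun x hx => lt_of_lt_of_le hx hεle.2).trans (hsmall t ht))
  have h3 : |t⁻¹ * ∫ x, f x * (1 - radialCutoff ε x) ∂(p t)| ≤ η / 4 := by
    rw [abs_mul, abs_of_pos (inv_pos.2 ht), inv_mul_le_iff₀ ht]
    linarith
  rw [Real.dist_eq] at hGt ⊢
  rw [hsplit _ hf, hsplit _ hfp]
  rw [abs_lt] at hGt ⊢
  rw [abs_le] at h1 h3
  rw [mul_add]
  constructor <;> linarith [hGt.1, hGt.2, h1.1, h1.2, h3.1, h3.2]

omit [InnerProductSpace ℝ E] [FiniteDimensional ℝ E] in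
lemma integrable_min_one_rpow_of_lintegral_lt_top {β : ℝ} (hβ : 0 ≤ β)
    (hlarge : ∫⁻ y, ENNReal.ofReal (min 1 (‖y‖ ^ 2)) ∂ν < ⊤)
    (hsmall : ∫⁻ y in {y : E | ‖y‖ < 1}, ENNReal.ofReal (‖y‖ ^ β) ∂ν < ⊤) :
    Integrable (fun y : E => min 1 (‖y‖ ^ β)) ν := by
  have hm : MeasurableSet {y : E | ‖y‖ < 1} := measurableSet_lt measurable_norm measurable_const
  refine ⟨by fun_prop (disch := exact hβ), ?_⟩
  rw [hasFiniteIntegral_iff_ofReal (Eventually.of_forall fun y => by positivity),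
    ← lintegral_add_compl _ hm, ENNReal.add_lt_top]
  constructor
  · refine lt_of_le_of_lt (setLIntegral_mono' hm fun y hy => ?_) hsmall
    exact ENNReal.ofReal_le_ofReal (min_le_right _ _)
  · refine lt_of_le_of_lt (setLIntegral_mono' hm.compl fun y hy => ?_)
      ((setLIntegral_le_lintegral _ _).trans_lt hlarge)
    have hy1 : 1 ≤ ‖y‖ := by simpa using hy
    rw [min_eq_left (one_le_pow₀ hy1)]
    exact ENNReal.ofReal_le_ofReal (min_le_left _ _)

end SmallTime

/-- Lemma 1 of the paper: for a Lévy process with triplet (0, γ, ν),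
∫_{‖x‖<1} ‖x‖^β ν(dx) < ∞ (0 ≤ β ≤ 2), and vanishing drift when β ≤ 1,
every bounded continuous F with |F(x) − F(0)| ≤ C‖x‖^β near 0 satisfies
t⁻¹ ∫ (F(x) − F(0)) p_t(dx) → ∫ (F(x) − F(0)) ν(dx) as t → 0+. -/
theorem small_time_limit_levy
    (d : ℕ) (hd : 1 ≤ d) (β : ℝ) (hβ0 : 0 ≤ β) (hβ2 : β ≤ 2)
    -- ν is a Lévy measure with the β-moment condition near 0
    (ν : Measure (EuclideanSpace ℝ (Fin d)))
    (hν0 : ν {0} = 0)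
    (hνlevy : ∫⁻ y, ENNReal.ofReal (min 1 (‖y‖ ^ 2)) ∂ν < ⊤)
    (hνβ : ∫⁻ y in {y : EuclideanSpace ℝ (Fin d) | ‖y‖ < 1},
      ENNReal.ofReal (‖y‖ ^ β) ∂ν < ⊤)
    (γ : EuclideanSpace ℝ (Fin d))
    -- if β ≤ 1 the drift γ₀ = ∫_{‖y‖≤1} y ν(dy) − γ vanishes
    (hγ0 : β ≤ 1 → γ = ∫ y in {y : EuclideanSpace ℝ (Fin d) | ‖y‖ ≤ 1}, y ∂ν)
    -- the characteristic exponent of the Lévy process with triplet (0, γ, ν)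
    (ψ : EuclideanSpace ℝ (Fin d) → ℂ)
    (hψ : ∀ ξ, ψ ξ = -Complex.I * (⟪ξ, γ⟫ : ℂ)
      - ∫ y, (Complex.exp (Complex.I * (⟪ξ, y⟫ : ℂ)) - 1
          - Complex.I * (if ‖y‖ ≤ 1 then (⟪ξ, y⟫ : ℂ) else 0)) ∂ν)
    -- (p t) are the marginal laws of the associated Lévy process
    (p : ℝ → Measure (EuclideanSpace ℝ (Fin d)))
    (hp : ∀ t, 0 ≤ t → IsProbabilityMeasure (p t))
    (hchar : ∀ t, 0 ≤ t → ∀ ξ,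
      ∫ x, Complex.exp (Complex.I * (⟪ξ, x⟫ : ℂ)) ∂(p t)
        = Complex.exp (-(t : ℂ) * ψ ξ))
    -- F bounded continuous with the Hölder-type condition at the origin
    (F : EuclideanSpace ℝ (Fin d) → ℝ)
    (hFc : Continuous F) (MF : ℝ) (hFbd : ∀ x, |F x| ≤ MF)
    (C : ℝ) (hC : 0 < C)
    (hFH : ∀ x : EuclideanSpace ℝ (Fin d), ‖x‖ < 1 → |F x - F 0| ≤ C * ‖x‖ ^ β) :
    Integrable (fun x => F x - F 0) ν ∧
      Tendsto (fun t : ℝ => t⁻¹ * ∫ x, (F x - F 0) ∂(p t)) (𝓝[>] 0)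
        (𝓝 (∫ x, (F x - F 0) ∂ν)) := by
  have hν := integrable_min_one_rpow_of_lintegral_lt_top hβ0 hνlevy hνβ
  have hψ' : ∀ ξ, ψ ξ = levyExponent γ ν ξ := hψ
  have hfM : ∀ x, |F x - F 0| ≤ MF + MF := fun x =>
    (abs_sub _ _).trans (add_le_add (hFbd x) (hFbd 0))
  refine ⟨integrable_of_abs_le_rpow hβ0 hν (by fun_prop) hfM hFH, ?_⟩
  refine tendsto_inv_mul_integral hν0 (fun t ht => hp t ht.le) (fun t ht ξ => ?_) hβ0 hβ2 hν hγ0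
    (f := fun x => F x - F 0) (by fun_prop) (sub_self _) hfM hC.le hFH
  rw [hchar t ht.le, hψ']
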